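/- arXiv:1706.08765 — 6 statements merged into one kernel-verified Lean document; each statement's English description precedes it below -/
import Mathlib

section
/- Assume in addition that g is simple, m ≥ 2, some Cartan subalgebra h of g is fixed pointwise by τ, g_0 = span⁅g_1, g_{m−1}⁆, g_k = span⁅g_{k−l}, g_l⁆ for all 0 ≤ l < k ≤ m−1, for each 1 ≤ k ≤ m−1 the g_0-module g_k (adjoint action) is irreducible with ⁅g_0, g_k⁆ = g_k, and g_0 = g^τ is a semisimple Lie algebra. Then L is not isomorphic, as a Lie algebra over ℂ, to any fixed-point algebra (a ⊗ A)^Γ, where a is a finite-dimensional semisimple Lie algebra over ℂ, A is a finitely generated commutative unital ℂ-algebra, and Γ is a finite abelian group acting on a by Lie algebra automorphisms and on A by ℂ-algebra automorphisms (hence diagonally on a ⊗ A) in such a way that the induced action of Γ on the set of maximal ideals of A is free (γ·M = M for some maximal ideal M implies γ = 1). -/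
open scoped TensorProduct

theorem LieIdeal.lie_self_eq_of_isSemisimple {R L : Type*} [CommRing R] [LieRing L]
    [LieAlgebra R L] [LieAlgebra.IsSemisimple R L] (I : LieIdeal R L) : ⁅I, I⁆ = I := by
  refine le_antisymm (LieSubmodule.lie_le_left I I) ?_
  have h : I ⊓ ⁅I, I⁆ᶜ = ⊥ := by
    refine (LieAlgebra.hasTrivialRadical_iff_no_abelian_ideals R L).mp inferInstance _ ?_
    rw [LieSubmodule.lie_abelian_iff_lie_self_eq_bot, eq_bot_iff]
    have h₁ : ⁅I ⊓ ⁅I, I⁆ᶜ, I ⊓ ⁅I, I⁆ᶜ⁆ ≤ ⁅I, I⁆ :=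
      LieSubmodule.mono_lie inf_le_left inf_le_left
    have h₂ : ⁅I ⊓ ⁅I, I⁆ᶜ, I ⊓ ⁅I, I⁆ᶜ⁆ ≤ ⁅I, I⁆ᶜ :=
      (LieSubmodule.lie_le_left _ _).trans inf_le_right
    exact (le_inf h₁ h₂).trans (inf_compl_eq_bot (a := ⁅I, I⁆)).le
  have h' := (disjoint_iff (a := I) (b := ⁅I, I⁆ᶜ)).mpr h
  exact (disjoint_compl_right_iff (x := I) (y := ⁅I, I⁆)).mp h'

/-- In a semisimple subalgebra, every element is a sum of brackets. -/
theorem LieSubalgebra.le_span_lie_of_isSemisimple {R L : Type*} [CommRing R] [LieRing L]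
    [LieAlgebra R L] (G : LieSubalgebra R L) [LieAlgebra.IsSemisimple R G] :
    G.toSubmodule ≤ Submodule.span R {z | ∃ x ∈ G, ∃ y ∈ G, z = ⁅x, y⁆} := by
  intro x hx
  have h : (⟨x, hx⟩ : G) ∈ LieSubmodule.toSubmodule ⁅(⊤ : LieIdeal R G), (⊤ : LieIdeal R G)⁆ := by
    rw [LieIdeal.lie_self_eq_of_isSemisimple]
    exact Submodule.mem_top
  rw [LieSubmodule.lieIdeal_oper_eq_linear_span'] at h
  have h' := Submodule.mem_map_of_mem (f := G.toSubmodule.subtype) h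
  rw [Submodule.map_span] at h'
  refine Submodule.span_mono ?_ h'
  rintro _ ⟨_, ⟨y, -, z, -, rfl⟩, rfl⟩
  exact ⟨y, y.2, z, z.2, rfl⟩

/-- An element of a semisimple subalgebra centralizing the subalgebra is zero. -/
theorem LieSubalgebra.eq_zero_of_isSemisimple {R L : Type*} [CommRing R] [LieRing L]
    [LieAlgebra R L] (G : LieSubalgebra R L) [LieAlgebra.IsSemisimple R G] {x : L} (hx : x ∈ G)
    (h : ∀ y ∈ G, ⁅y, x⁆ = 0) : x = 0 := by
  have : (⟨x, hx⟩ : G) ∈ LieAlgebra.center R G :=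
    (LieModule.mem_maxTrivSubmodule R G G _).mpr fun y => Subtype.ext (h y y.2)
  rw [LieAlgebra.center_eq_bot] at this
  exact congrArg Subtype.val ((LieSubmodule.mem_bot _).mp this)

theorem lie_eq_zero_of_mem_span_lie {R L : Type*} [CommRing R] [LieRing L] [LieAlgebra R L]
    {S T : Submodule R L} {x z : L} (hS : ∀ y ∈ S, ⁅y, x⁆ = 0) (hT : ∀ y ∈ T, ⁅y, x⁆ = 0)
    (hz : z ∈ Submodule.span R {z | ∃ s ∈ S, ∃ t ∈ T, z = ⁅s, t⁆}) : ⁅z, x⁆ = 0 := by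
  induction hz using Submodule.span_induction with
  | mem z hz =>
    obtain ⟨s, hs, t, ht, rfl⟩ := hz
    rw [lie_lie, hS s hs, hT t ht, lie_zero, lie_zero, sub_zero]
  | zero => exact zero_lie x
  | add z w _ _ hz hw => rw [add_lie, hz, hw, add_zero]
  | smul c z _ hz => rw [smul_lie, hz, smul_zero]

section FreeAction

variable {k A Γ : Type*} [Field k] [CommRing A] [Algebra k A] [Group Γ]
  (ψ : Γ → (A →ₐ[k] A))

/-- Freeness on maximal ideals produces a separability element. -/
theorem exists_tensor_lmul'_eq_ite [Finite Γ] [DecidableEq Γ] (h1 : ∀ y, ψ 1 y = y)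
    (hfree : ∀ (γ : Γ) (M : Ideal A), M.IsMaximal →
      Ideal.comap (ψ γ : A →+* A) M = M → γ = 1) :
    ∃ t : A ⊗[k] A, ∀ γ, Algebra.TensorProduct.productMap (AlgHom.id k A) (ψ γ) t =
      if γ = 1 then 1 else 0 := by
  have : Fintype Γ := Fintype.ofFinite Γ
  set μ : Γ → (A ⊗[k] A →ₐ[k] A) :=
    fun γ => Algebra.TensorProduct.productMap (AlgHom.id k A) (ψ γ) with hμ
  have hμt : ∀ γ x y, μ γ (x ⊗ₜ y) = x * ψ γ y := fun γ x y => by simp [hμ]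
  have hs : ∀ γ, Function.Surjective (μ γ) := fun γ x => ⟨x ⊗ₜ 1, by simp [hμt]⟩
  have key : ∀ γ : Γ, γ ≠ 1 → ∃ t, μ 1 t = 1 ∧ μ γ t = 0 := by
    intro γ hγ
    have htop : Ideal.map (μ γ) (RingHom.ker (μ 1)) = ⊤ := by
      by_contra hne
      obtain ⟨M, hM, hle⟩ := Ideal.exists_le_maximal _ hne
      refine hγ (hfree γ M hM ?_)
      have hd : ∀ x, ψ γ x - x ∈ M := fun x => by
        have : (1 ⊗ₜ x - x ⊗ₜ 1 : A ⊗[k] A) ∈ RingHom.ker (μ 1) := by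
          simp [RingHom.mem_ker, hμt, h1]
        have := hle (Ideal.mem_map_of_mem (μ γ) this)
        simpa [hμt] using this
      ext x
      rw [Ideal.mem_comap]
      constructor
      · intro hx
        have := M.sub_mem hx (hd x)
        simpa using this
      · intro hx
        have := M.add_mem hx (hd x)
        simpa using this
    have h1m : (1 : A) ∈ Ideal.map (μ γ) (RingHom.ker (μ 1)) := htop ▸ Submodule.mem_top
    obtain ⟨s, hs1, hs2⟩ := (Ideal.mem_map_iff_of_surjective (μ γ) (hs γ)).mp h1m
    exact ⟨1 - s, by simp [(RingHom.mem_ker).mp hs1], by simp [hs2]⟩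
  choose! t ht1 ht2 using key
  refine ⟨∏ γ ∈ Finset.univ.erase 1, t γ, fun γ => ?_⟩
  change μ γ _ = _
  rw [map_prod]
  split_ifs with h
  · subst h
    exact Finset.prod_eq_one fun δ hδ => ht1 δ (Finset.ne_of_mem_erase hδ)
  · exact Finset.prod_eq_zero (Finset.mem_erase.mpr ⟨h, Finset.mem_univ γ⟩) (ht2 γ h)

/-- A family of invariants closed under multiplication by invariants and missing `1`
lies in the kernel of a point of `A`. -/
theorem exists_algHom_eq_zero_of_invariant [IsAlgClosed k] [CharZero k] [Fintype Γ]
    [Algebra.FiniteType k A]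
    (hmul : ∀ (γ δ : Γ) (y : A), ψ (γ * δ) y = ψ γ (ψ δ y))
    (𝔪 : AddSubmonoid A) (hinv : ∀ b ∈ 𝔪, ∀ γ, ψ γ b = b)
    (hsmul : ∀ b ∈ 𝔪, ∀ c, (∀ γ, ψ γ c = c) → c * b ∈ 𝔪) (h1 : (1 : A) ∉ 𝔪) :
    ∃ χ : A →ₐ[k] k, ∀ b ∈ 𝔪, χ b = 0 := by
  have hcard : (Fintype.card Γ : k) ≠ 0 := Nat.cast_ne_zero.mpr Fintype.card_ne_zero
  have hne : Ideal.span (𝔪 : Set A) ≠ ⊤ := by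
    intro htop
    have havg : ∀ x ∈ Ideal.span (𝔪 : Set A), ∀ a, ∑ γ, ψ γ (a * x) ∈ 𝔪 := by
      intro x hx
      induction hx using Submodule.span_induction with
      | mem x hx =>
        intro a
        have : ∑ γ, ψ γ (a * x) = (∑ γ, ψ γ a) * x := by
          simp [hinv x hx, Finset.sum_mul]
        rw [this]
        refine hsmul x hx _ fun γ => ?_
        simp only [map_sum, ← hmul]
        exact Fintype.sum_equiv (Equiv.mulLeft γ) _ _ fun _ => rfl
      | zero => simp
      | add x y _ _ hx hy =>
        intro a
        simpa [mul_add, Finset.sum_add_distrib] using add_mem (hx a) (hy a)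
      | smul c x _ hx =>
        intro a
        simpa only [smul_eq_mul, mul_assoc] using hx (a * c)
    refine h1 ?_
    have := havg 1 (htop ▸ Submodule.mem_top) (algebraMap k A (Fintype.card Γ : k)⁻¹)
    have hc : (Fintype.card Γ : A) * algebraMap k A (Fintype.card Γ : k)⁻¹ = 1 := by
      rw [← map_natCast (algebraMap k A), ← map_mul, mul_inv_cancel₀ hcard, map_one]
    simpa only [mul_one, AlgHom.commutes, Finset.sum_const, Finset.card_univ, nsmul_eq_mul,
      hc] using this
  obtain ⟨M, hM, hle⟩ := Ideal.exists_le_maximal _ hne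
  let _ : Field (A ⧸ M) := Ideal.Quotient.field M
  have : Module.Finite k (A ⧸ M) := finite_of_finite_type_of_isJacobsonRing k (A ⧸ M)
  have hbij : Function.Bijective (algebraMap k (A ⧸ M)) :=
    IsAlgClosed.algebraMap_bijective_of_isIntegral
  refine ⟨(AlgEquiv.ofBijective (Algebra.ofId k (A ⧸ M)) hbij).symm.toAlgHom.comp
    (Ideal.Quotient.mkₐ k M), fun b hb => ?_⟩
  have hb0 : Ideal.Quotient.mkₐ k M b = 0 :=
    Ideal.Quotient.eq_zero_iff_mem.mpr (hle (Ideal.subset_span hb))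
  rw [AlgHom.comp_apply, hb0, map_zero]

variable {a : Type*} [LieRing a] [LieAlgebra k a]

/-- Evaluation of `A ⊗ a` at a `k`-point of `A`. -/
noncomputable def evalPoint (a : Type*) [LieRing a] [LieAlgebra k a] (χ : A →ₐ[k] k) :
    A ⊗[k] a →ₗ[k] a :=
  (TensorProduct.lid k a).toLinearMap ∘ₗ χ.toLinearMap.rTensor a

@[simp] theorem evalPoint_tmul (χ : A →ₐ[k] k) (f : A) (x : a) :
    evalPoint a χ (f ⊗ₜ x) = χ f • x := by simp [evalPoint]

theorem evalPoint_lie (χ : A →ₐ[k] k) (u v : A ⊗[k] a) :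
    evalPoint a χ ⁅u, v⁆ = ⁅evalPoint a χ u, evalPoint a χ v⁆ := by
  induction u using TensorProduct.induction_on with
  | zero => simp
  | add u₁ u₂ h₁ h₂ => simp [h₁, h₂]
  | tmul f x =>
    induction v using TensorProduct.induction_on with
    | zero => simp
    | add v₁ v₂ h₁ h₂ => simp [h₁, h₂]
    | tmul h y =>
      rw [LieAlgebra.ExtendScalars.bracket_tmul, evalPoint_tmul, evalPoint_tmul, evalPoint_tmul,
        smul_lie, lie_smul, map_mul, mul_smul]

/-- An ideal of the equivariant map algebra of a free action that is abelian modulo a subspace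
`K`, on whose quotient the invariants act by scalars, is contained in `K`. -/
theorem le_of_lie_mem_of_free_action [IsAlgClosed k] [CharZero k] [Finite Γ]
    [Algebra.FiniteType k A] [FiniteDimensional k a] [LieAlgebra.IsSemisimple k a]
    (φ : Γ → (a →ₗ⁅k⁆ a))
    (hφ1 : ∀ x, φ 1 x = x) (hφmul : ∀ (γ δ : Γ) (x : a), φ (γ * δ) x = φ γ (φ δ x))
    (hψ1 : ∀ y, ψ 1 y = y) (hψmul : ∀ (γ δ : Γ) (y : A), ψ (γ * δ) y = ψ γ (ψ δ y))
    (hfree : ∀ (γ : Γ) (M : Ideal A), M.IsMaximal →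
      Ideal.comap (ψ γ : A →+* A) M = M → γ = 1)
    (F K R : Submodule k (A ⊗[k] a))
    (hF : ∀ z, z ∈ F ↔ ∀ γ, TensorProduct.map (ψ γ).toLinearMap (φ γ).toLinearMap z = z)
    (hKF : K < F) (hRF : R ≤ F)
    (hFR : ∀ u ∈ F, ∀ v ∈ R, ⁅u, v⁆ ∈ R) (hRR : ∀ u ∈ R, ∀ v ∈ R, ⁅u, v⁆ ∈ K)
    (hscal : ∀ b : A, (∀ γ, ψ γ b = b) → ∃ c : k, ∀ z ∈ F, b • z - c • z ∈ K) :
    R ≤ K := by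
  classical
  have : Fintype Γ := Fintype.ofFinite Γ
  have hcard : (Fintype.card Γ : k) ≠ 0 := Nat.cast_ne_zero.mpr Fintype.card_ne_zero
  set T : Γ → (A ⊗[k] a →ₗ[k] A ⊗[k] a) :=
    fun γ => TensorProduct.map (ψ γ).toLinearMap (φ γ).toLinearMap with hT
  have hTt : ∀ γ f x, T γ (f ⊗ₜ x) = ψ γ f ⊗ₜ φ γ x := fun γ f x => by simp [hT]
  have hTsmul : ∀ γ (b : A) z, T γ (b • z) = ψ γ b • T γ z := fun γ b z => by
    induction z using TensorProduct.induction_on with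
    | zero => simp
    | add u v hu hv => simp [hu, hv]
    | tmul f x => simp [hTt, TensorProduct.smul_tmul']
  have hTmul : ∀ γ δ z, T γ (T δ z) = T (γ * δ) z := fun γ δ z => by
    induction z using TensorProduct.induction_on with
    | zero => simp
    | add u v hu hv => simp [hu, hv]
    | tmul f x => simp [hTt, hφmul, hψmul]
  have hTr : ∀ z, ∑ γ, T γ z ∈ F := fun z => (hF _).mpr fun γ => by
    change T γ _ = _
    simp only [map_sum, hTmul]
    exact Fintype.sum_equiv (Equiv.mulLeft γ) _ _ fun _ => rfl
  have hFsmul : ∀ b : A, (∀ γ, ψ γ b = b) → ∀ z ∈ F, b • z ∈ F := fun b hb z hz =>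
    (hF _).mpr fun γ => by
      change T γ _ = _
      rw [hTsmul, hb, show T γ z = z from (hF z).mp hz γ]
  let 𝔪 : AddSubmonoid A :=
    { carrier := {b | (∀ γ, ψ γ b = b) ∧ ∀ z ∈ F, b • z ∈ K}
      zero_mem' := by simp
      add_mem' := fun {b c} hb hc => ⟨fun γ => by rw [map_add, hb.1, hc.1], fun z hz => by
        rw [add_smul]; exact K.add_mem (hb.2 z hz) (hc.2 z hz)⟩ }
  obtain ⟨χ, hχ⟩ := exists_algHom_eq_zero_of_invariant ψ hψmul 𝔪 (fun b hb => hb.1)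
    (fun b hb c hc => ⟨fun γ => by rw [map_mul, hb.1, hc], fun z hz => by
      rw [mul_comm, mul_smul]; exact hb.2 _ (hFsmul c hc z hz)⟩)
    (fun h => hKF.not_ge fun z hz => by simpa using h.2 z hz)
  have hχm : ∀ b, (∀ γ, ψ γ b = b) → χ b = 0 → ∀ z ∈ F, b • z ∈ K := by
    intro b hb hb0
    obtain ⟨c, hc⟩ := hscal b hb
    have hmem : b - algebraMap k A c ∈ 𝔪 := ⟨fun γ => by simp [hb], fun z hz => by
      simpa [sub_smul] using hc z hz⟩
    have h0 := hχ _ hmem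
    have hc0 : c = 0 := by simpa [hb0] using h0
    simpa [hc0] using hc
  obtain ⟨t, ht⟩ := exists_tensor_lmul'_eq_ite ψ hψ1 hfree
  obtain ⟨s, rfl⟩ := TensorProduct.exists_finset t
  have hδ : ∀ γ, ∑ i ∈ s, i.1 * ψ γ i.2 = if γ = 1 then 1 else 0 := fun γ => by
    simpa using ht γ
  have hsurj : ∀ x : a, ∃ z ∈ F, evalPoint a χ z = x := by
    intro x
    refine ⟨∑ γ, T γ ((∑ i ∈ s, χ i.1 • i.2) ⊗ₜ x), hTr _, ?_⟩
    have h : ∀ γ, χ (ψ γ (∑ i ∈ s, χ i.1 • i.2)) = if γ = 1 then 1 else 0 := fun γ => by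
      have := congrArg χ (hδ γ)
      simpa [apply_ite χ] using this
    simp only [map_sum (evalPoint a χ), hTt, evalPoint_tmul, h, ite_smul, one_smul, zero_smul,
      Finset.sum_ite_eq', Finset.mem_univ, if_true, hφ1]
  have hker : ∀ z ∈ F, evalPoint a χ z = 0 → z ∈ K := by
    intro z hz hz0
    let β := Module.finBasis k a
    obtain ⟨f, hf⟩ : ∃ f : Fin (Module.finrank k a) → A, z = ∑ j, f j ⊗ₜ β j := by
      refine ⟨fun j => (β.baseChange A).repr z j, ?_⟩
      conv_lhs => rw [← (β.baseChange A).sum_repr z]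
      simp [TensorProduct.smul_tmul']
    have hχf : ∀ γ j, χ (ψ γ (f j)) = 0 := by
      intro γ
      have h : evalPoint a (χ.comp (ψ γ)) z = 0 := by
        have hcomm : ∀ w, φ γ (evalPoint a (χ.comp (ψ γ)) w) = evalPoint a χ (T γ w) := by
          intro w
          induction w using TensorProduct.induction_on with
          | zero => simp
          | add u v hu hv => simp [hu, hv]
          | tmul f x => simp [hTt]
        have h := hcomm z
        rw [show T γ z = z from (hF z).mp hz γ, hz0] at h
        rw [← hφ1 (evalPoint a _ z), ← inv_mul_cancel γ, hφmul, h, map_zero]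
      rw [hf] at h
      simp only [map_sum, evalPoint_tmul, AlgHom.comp_apply] at h
      exact Fintype.linearIndependent_iff.mp β.linearIndependent _ h
    have hfx : ∀ p : A, p = ∑ i ∈ s, (∑ γ, ψ γ (i.2 * p)) * i.1 := by
      intro p
      have : ∑ i ∈ s, (∑ γ, ψ γ (i.2 * p)) * i.1
          = ∑ γ, (∑ i ∈ s, i.1 * ψ γ i.2) * ψ γ p := by
        simp only [Finset.sum_mul, map_mul]
        rw [Finset.sum_comm]
        exact Finset.sum_congr rfl fun _ _ => Finset.sum_congr rfl fun _ _ => by ring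
      rw [this]
      simp [hδ, hψ1]
    have hinv : ∀ p γ, ψ γ (∑ δ, ψ δ p) = ∑ δ, ψ δ p := fun p γ => by
      simp only [map_sum, ← hψmul]
      exact Fintype.sum_equiv (Equiv.mulLeft γ) _ _ fun _ => rfl
    have hsum : (Fintype.card Γ : k) • z =
        ∑ j, ∑ i ∈ s, (∑ γ, ψ γ (i.2 * f j)) • ∑ γ, T γ (i.1 ⊗ₜ β j) := by
      have h1 : (Fintype.card Γ : k) • z = ∑ γ, T γ z := by
        rw [Finset.sum_congr rfl fun γ _ => (hF z).mp hz γ]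
        simp [Nat.cast_smul_eq_nsmul]
      have h2 : ∀ j, f j ⊗ₜ[k] β j =
          ∑ i ∈ s, (∑ γ, ψ γ (i.2 * f j)) • (i.1 ⊗ₜ[k] β j : A ⊗[k] a) := fun j => by
        conv_lhs => rw [hfx (f j)]
        simp only [TensorProduct.sum_tmul, TensorProduct.smul_tmul', smul_eq_mul]
      rw [h1, hf]
      simp only [map_sum (T _)]
      rw [Finset.sum_comm]
      refine Finset.sum_congr rfl fun j _ => ?_
      simp only [h2, map_sum (T _), hTsmul, hinv]
      rw [Finset.sum_comm]
      simp only [Finset.smul_sum]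
    have hmem : (Fintype.card Γ : k) • z ∈ K := by
      rw [hsum]
      refine K.sum_mem fun j _ => K.sum_mem fun i _ => hχm _ (hinv _) ?_ _ (hTr _)
      simp [hχf]
    exact (K.smul_mem_iff hcard).mp hmem
  let r : LieIdeal k a :=
    { R.map (evalPoint a χ) with
      lie_mem := by
        rintro x _ ⟨v, hv, rfl⟩
        obtain ⟨u, hu, rfl⟩ := hsurj x
        exact ⟨⁅u, v⁆, hFR u hu v hv, evalPoint_lie χ u v⟩ }
  have hr : R.map (evalPoint a χ) ≤ K.map (evalPoint a χ) := by
    have h : LieSubmodule.toSubmodule ⁅r, r⁆ ≤ K.map (evalPoint a χ) := by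
      rw [LieSubmodule.lieIdeal_oper_eq_linear_span', Submodule.span_le]
      rintro _ ⟨_, ⟨u, hu, rfl⟩, _, ⟨v, hv, rfl⟩, rfl⟩
      exact ⟨⁅u, v⁆, hRR u hu v hv, evalPoint_lie χ u v⟩
    rwa [LieIdeal.lie_self_eq_of_isSemisimple] at h
  intro v hv
  obtain ⟨w, hw, hwv⟩ := hr ⟨v, hv, rfl⟩
  have := hker (v - w) (F.sub_mem (hRF hv) (hKF.le hw)) (by rw [map_sub, hwv, sub_self])
  simpa using K.add_mem this hw

end FreeAction

section TwistedCurrent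

variable {k P g : Type*} [Field k] [CommRing P] [Algebra k P] [LieRing g] [LieAlgebra k g]
  (e : P ≃ₐ[k] Polynomial k)

/-- The coefficient of `t ^ n` of an element of the current algebra `P ⊗ g`, where `P ≃ k[t]`. -/
noncomputable def tcoeff (g : Type*) [LieRing g] [LieAlgebra k g] (e : P ≃ₐ[k] Polynomial k)
    (n : ℕ) : P ⊗[k] g →ₗ[k] g :=
  (TensorProduct.lid k g).toLinearMap ∘ₗ (Polynomial.lcoeff k n ∘ₗ e.toLinearMap).rTensor g

@[simp] theorem tcoeff_tmul (n : ℕ) (f : P) (x : g) :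
    tcoeff g e n (f ⊗ₜ x) = (e f).coeff n • x := by simp [tcoeff]

theorem tcoeff_lie (n : ℕ) (u v : P ⊗[k] g) :
    tcoeff g e n ⁅u, v⁆ =
      ∑ p ∈ Finset.HasAntidiagonal.antidiagonal n, ⁅tcoeff g e p.1 u, tcoeff g e p.2 v⁆ := by
  induction u using TensorProduct.induction_on with
  | zero => simp
  | add u₁ u₂ h₁ h₂ => simp [h₁, h₂, Finset.sum_add_distrib]
  | tmul f x =>
    induction v using TensorProduct.induction_on with
    | zero => simp
    | add v₁ v₂ h₁ h₂ => simp [h₁, h₂, Finset.sum_add_distrib]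
    | tmul h y =>
      simp only [LieAlgebra.ExtendScalars.bracket_tmul, tcoeff_tmul, map_mul, Polynomial.coeff_mul,
        smul_lie, lie_smul, smul_smul, Finset.sum_smul, mul_comm]

theorem tcoeff_X_pow_tmul_lie (n i : ℕ) (x : g) (w : P ⊗[k] g) :
    tcoeff g e n ⁅(e.symm Polynomial.X ^ i) ⊗ₜ[k] x, w⁆ =
      if i ≤ n then ⁅x, tcoeff g e (n - i) w⁆ else 0 := by
  induction w using TensorProduct.induction_on with
  | zero => simp
  | add u₁ u₂ h₁ h₂ => simp only [lie_add, map_add, h₁, h₂]; split_ifs <;> simp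
  | tmul f y =>
    simp only [LieAlgebra.ExtendScalars.bracket_tmul, tcoeff_tmul, map_mul, map_pow,
      AlgEquiv.apply_symm_apply, Polynomial.coeff_X_pow_mul']
    split_ifs <;> simp

theorem exists_eq_sum_X_pow_tmul_tcoeff (u : P ⊗[k] g) :
    ∃ N : ℕ, u = ∑ j ∈ Finset.range N, (e.symm Polynomial.X ^ j) ⊗ₜ[k] tcoeff g e j u := by
  suffices h : ∃ N : ℕ, ∀ M ≥ N,
      u = ∑ j ∈ Finset.range M, (e.symm Polynomial.X ^ j) ⊗ₜ[k] tcoeff g e j u from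
    h.imp fun N h => h N le_rfl
  induction u using TensorProduct.induction_on with
  | zero => exact ⟨0, by simp⟩
  | add u v hu hv =>
    obtain ⟨N₁, h₁⟩ := hu
    obtain ⟨N₂, h₂⟩ := hv
    refine ⟨max N₁ N₂, fun M hM => ?_⟩
    simp only [map_add, TensorProduct.tmul_add, Finset.sum_add_distrib]
    rw [← h₁ M (le_of_max_le_left hM), ← h₂ M (le_of_max_le_right hM)]
  | tmul f x =>
    refine ⟨(e f).natDegree + 1, fun M hM => ?_⟩
    have hf : f = ∑ j ∈ Finset.range M, (e f).coeff j • e.symm Polynomial.X ^ j := by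
      apply e.injective
      conv_lhs => rw [(e f).as_sum_range' M (by omega)]
      simp [← Polynomial.smul_X_eq_monomial]
    conv_lhs => rw [hf]
    simp [TensorProduct.sum_tmul, TensorProduct.smul_tmul]

variable {m : ℕ} {H : LieSubalgebra k g} {gk : ℕ → Submodule k g}
  {L : LieSubalgebra k (P ⊗[k] g)}

theorem X_pow_tmul_mem (hL : ∀ u, u ∈ L ↔ ∀ n, tcoeff g e n u ∈ gk n) {i : ℕ} {x : g}
    (hx : x ∈ gk i) : (e.symm Polynomial.X ^ i) ⊗ₜ[k] x ∈ L := by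
  refine (hL _).mpr fun n => ?_
  rw [tcoeff_tmul, map_pow, AlgEquiv.apply_symm_apply, Polynomial.coeff_X_pow]
  split_ifs with h
  · simpa [h] using hx
  · simp

/-- A centroid element that vanishes in degree one vanishes modulo `t ^ m`. -/
theorem tcoeff_centroid_eq_zero [H.IsCartanSubalgebra]
    (hL : ∀ u, u ∈ L ↔ ∀ n, tcoeff g e n u ∈ gk n)
    (hlie : ∀ {i j x y}, x ∈ gk i → y ∈ gk j → ⁅x, y⁆ ∈ gk (i + j))
    (hH0 : ∀ x ∈ H, x ∈ gk 0) (hHk : ∀ n, 0 < n → n < m → ∀ x ∈ H, x ∈ gk n → x = 0)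
    (hperf : ∀ n, gk n ≤ Submodule.span k {z | ∃ x ∈ gk 0, ∃ y ∈ gk n, z = ⁅x, y⁆})
    (hcent : ∀ x ∈ gk 0, (∀ y ∈ gk 1, ⁅y, x⁆ = 0) → x = 0)
    (b : L →ₗ[k] L) (hb : ∀ u v, b ⁅u, v⁆ = ⁅b u, v⁆)
    (hb1 : ∀ u : L, ∀ x ∈ gk 1, (u : P ⊗[k] g) = (e.symm Polynomial.X ^ 1) ⊗ₜ[k] x →
      tcoeff g e 1 (b u) = 0) (u : L) (n : ℕ) (hn : n < m) : tcoeff g e n (b u) = 0 := by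
  have hb' : ∀ u v, b ⁅u, v⁆ = ⁅u, b v⁆ := fun u v => by
    rw [← lie_skew, map_neg, hb, lie_skew]
  let E : ∀ (i : ℕ) (x : g), x ∈ gk i → L := fun i x hx => ⟨_, X_pow_tmul_mem e hL hx⟩
  have hE : ∀ i x hx (w : L) n, tcoeff g e n (⁅E i x hx, w⁆ : L) =
      if i ≤ n then ⁅x, tcoeff g e (n - i) w⁆ else 0 := fun i x hx w n =>
    tcoeff_X_pow_tmul_lie e n i x w
  have hEE : ∀ i x hx j y hy, ⁅E i x hx, E j y hy⁆ = E (i + j) ⁅x, y⁆ (hlie hx hy) :=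
    fun i x hx j y hy => Subtype.ext <| by
      simp [E, LieAlgebra.ExtendScalars.bracket_tmul, pow_add]
  have h0 : ∀ x hx, tcoeff g e 0 (b (E 0 x hx)) = 0 := by
    intro x hx
    refine hcent _ ((hL _).mp (b _).2 0) fun y hy => ?_
    have h := hE 1 y hy (b (E 0 x hx)) 1
    rw [← hb', hEE _ _ hy _ _ hx, hb1 _ _ (hlie hy hx) rfl] at h
    simpa using h.symm
  have hmemH : ∀ w, (∀ h ∈ H, ⁅h, w⁆ ∈ H) → w ∈ H := fun w hw => by
    rw [← LieSubalgebra.IsCartanSubalgebra.self_normalizing (H := H)]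
    exact (H.mem_normalizer_iff' w).mpr hw
  have hHn : ∀ n < m, ∀ x (hx : x ∈ H), tcoeff g e n (b (E 0 x (hH0 x hx))) = 0 := by
    intro n hn
    rcases Nat.eq_zero_or_pos n with rfl | hpos
    · exact fun x hx => h0 x (hH0 x hx)
    have hucs : ∀ j, ∀ x ∈ (⊥ : LieSubmodule k H H).ucs j,
        tcoeff g e n (b (E 0 x (hH0 x x.2))) = 0 := by
      intro j
      induction j with
      | zero =>
        intro x hx
        have hx0 : x = 0 := by simpa using hx
        have : E 0 x (hH0 x x.2) = 0 := Subtype.ext <| by simp [E, hx0]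
        simp [this]
      | succ j ih =>
        intro x hx
        rw [LieSubmodule.ucs_succ, LieSubmodule.mem_normalizer] at hx
        refine hHk n hpos hn _ (hmemH _ fun h hh => ?_) ((hL _).mp (b _).2 n)
        have h1 := hE 0 h (hH0 h hh) (b (E 0 x (hH0 x x.2))) n
        rw [← hb', hEE _ _ (hH0 h hh) _ _ (hH0 x x.2)] at h1
        have h2 := ih _ (hx ⟨h, hh⟩)
        rw [if_pos (Nat.zero_le n), Nat.sub_zero] at h1
        rw [← h1]
        exact h2 ▸ H.zero_mem
    obtain ⟨j, hj⟩ :=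
      (LieModule.isNilpotent_iff_exists_ucs_eq_top k (L := H) (M := H)).mp inferInstance
    exact fun x hx => hucs j ⟨x, hx⟩ (hj ▸ LieSubmodule.mem_top _)
  have h0n : ∀ n < m, ∀ x hx, tcoeff g e n (b (E 0 x hx)) = 0 := by
    intro n hn x hx
    rcases Nat.eq_zero_or_pos n with rfl | hpos
    · exact h0 x hx
    refine hHk n hpos hn _ (hmemH _ fun h hh => ?_) ((hL _).mp (b _).2 n)
    have h1 := hE 0 h (hH0 h hh) (b (E 0 x hx)) n
    rw [← hb', hb, ← lie_skew] at h1
    have h2 := hE 0 x hx (b (E 0 h (hH0 h hh))) n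
    rw [if_pos (Nat.zero_le n), Nat.sub_zero] at h1 h2
    rw [hHn n hn h hh, lie_zero] at h2
    rw [← h1, NegMemClass.coe_neg, map_neg, h2, neg_zero]
    exact H.zero_mem
  have hjn : ∀ j, ∀ x ∈ gk j, ∃ u : L, (u : P ⊗[k] g) = (e.symm Polynomial.X ^ j) ⊗ₜ[k] x ∧
      ∀ n < m, tcoeff g e n (b u) = 0 := by
    intro j x hx
    have hx' := hperf j hx
    clear hx
    induction hx' using Submodule.span_induction with
    | mem x hx =>
      obtain ⟨y, hy, z, hz, rfl⟩ := hx
      refine ⟨⁅E 0 y hy, E j z hz⁆, by simp [E, LieAlgebra.ExtendScalars.bracket_tmul],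
        fun n hn => ?_⟩
      rw [hb, ← lie_skew]
      have h2 := hE j z hz (b (E 0 y hy)) n
      rw [h0n _ (by omega) y hy, lie_zero, ite_self] at h2
      rw [NegMemClass.coe_neg, map_neg, h2, neg_zero]
    | zero => exact ⟨0, by simp, by simp⟩
    | add x y _ _ hx hy =>
      obtain ⟨u, hu, hu'⟩ := hx
      obtain ⟨v, hv, hv'⟩ := hy
      exact ⟨u + v, by simp [hu, hv, TensorProduct.tmul_add], fun n hn => by
        simp [hu' n hn, hv' n hn]⟩
    | smul c x _ hx =>
      obtain ⟨u, hu, hu'⟩ := hx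
      exact ⟨c • u, by simp [hu], fun n hn => by simp [hu' n hn]⟩
  obtain ⟨N, hN⟩ := exists_eq_sum_X_pow_tmul_tcoeff e (u : P ⊗[k] g)
  choose v hv hv' using fun j => hjn j _ ((hL u).mp u.2 j)
  have hu : u = ∑ j ∈ Finset.range N, v j := Subtype.ext <| by
    rw [hN]
    simp [hv]
  rw [hu, map_sum]
  simp [hv' _ n hn]

/-- The centroid acts by scalars on the truncation modulo `t ^ m`. -/
theorem exists_tcoeff_centroid_eq_smul [IsAlgClosed k] [FiniteDimensional k g]
    [H.IsCartanSubalgebra]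
    (hL : ∀ u, u ∈ L ↔ ∀ n, tcoeff g e n u ∈ gk n)
    (hlie : ∀ {i j x y}, x ∈ gk i → y ∈ gk j → ⁅x, y⁆ ∈ gk (i + j))
    (hH0 : ∀ x ∈ H, x ∈ gk 0) (hHk : ∀ n, 0 < n → n < m → ∀ x ∈ H, x ∈ gk n → x = 0)
    (hperf : ∀ n, gk n ≤ Submodule.span k {z | ∃ x ∈ gk 0, ∃ y ∈ gk n, z = ⁅x, y⁆})
    (hcent : ∀ x ∈ gk 0, (∀ y ∈ gk 1, ⁅y, x⁆ = 0) → x = 0)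
    (hne : gk 1 ≠ ⊥)
    (hirr : ∀ W ≤ gk 1, (∀ x ∈ gk 0, ∀ w ∈ W, ⁅x, w⁆ ∈ W) → W = ⊥ ∨ W = gk 1)
    (b : L →ₗ[k] L) (hb : ∀ u v, b ⁅u, v⁆ = ⁅b u, v⁆) :
    ∃ c : k, ∀ u : L, ∀ n < m, tcoeff g e n (b u) = c • tcoeff g e n u := by
  have hb' : ∀ u v, b ⁅u, v⁆ = ⁅u, b v⁆ := fun u v => by
    rw [← lie_skew, map_neg, hb, lie_skew]
  let E : gk 1 →ₗ[k] L :=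
    { toFun := fun x => ⟨_, X_pow_tmul_mem e hL x.2⟩
      map_add' := fun x y => Subtype.ext <| by simp [TensorProduct.tmul_add]
      map_smul' := fun c x => Subtype.ext <| by simp }
  let β : Module.End k (gk 1) :=
    (tcoeff g e 1 ∘ₗ L.toSubmodule.subtype ∘ₗ b ∘ₗ E).codRestrict (gk 1)
      fun x => (hL _).mp (b (E x)).2 1
  have : Nontrivial (gk 1) := (Submodule.nontrivial_iff_ne_bot).mpr hne
  obtain ⟨c, hc⟩ := Module.End.exists_eigenvalue β
  have hW : (β.eigenspace c).map (gk 1).subtype = gk 1 := by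
    refine (hirr _ (Submodule.map_subtype_le _ _) ?_).resolve_left ?_
    · rintro y hy _ ⟨x, hx, rfl⟩
      have hyx : ⁅y, (x : g)⁆ ∈ gk 1 := by simpa using hlie hy x.2
      refine ⟨⟨_, hyx⟩, ?_, rfl⟩
      rw [SetLike.mem_coe, Module.End.mem_eigenspace_iff] at hx ⊢
      refine Subtype.ext ?_
      have hx' : tcoeff g e 1 (b (E x)) = c • (x : g) := congrArg Subtype.val hx
      change tcoeff g e 1 (b (E ⟨_, hyx⟩)) = c • ⁅y, (x : g)⁆
      have hEE : E ⟨_, hyx⟩ = ⁅(⟨_, X_pow_tmul_mem e hL hy⟩ : L), E x⁆ := Subtype.ext <| by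
        simp [E, LieAlgebra.ExtendScalars.bracket_tmul]
      rw [hEE, hb', ← lie_smul, ← hx']
      exact (tcoeff_X_pow_tmul_lie e 1 0 y _).trans (by simp)
    · intro h
      exact hc (Submodule.map_injective_of_injective (Submodule.subtype_injective _)
        (by rw [h, Submodule.map_bot]))
  refine ⟨c, fun u n hn => ?_⟩
  have h := tcoeff_centroid_eq_zero e hL hlie hH0 hHk hperf hcent (b - c • LinearMap.id)
    (fun u v => by simp [hb]) ?_ u n hn
  · simpa [sub_eq_zero] using h
  · intro u x hx hu
    obtain ⟨x, hx', rfl⟩ := hW.symm ▸ hx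
    rw [SetLike.mem_coe, Module.End.mem_eigenspace_iff] at hx'
    have hx'' : tcoeff g e 1 (b (E x)) = c • (x : g) := congrArg Subtype.val hx'
    obtain rfl : u = E x := Subtype.ext hu
    have hE : tcoeff g e 1 (E x : P ⊗[k] g) = x := by simp [E]
    simp [hx'', hE, -LinearMap.coe_mk]

theorem mem_iff_tcoeff_mem_of_twist {ζ : k} (hζ : ζ ≠ 0) (τ : g →ₗ[k] g)
    (hgk : ∀ n x, x ∈ gk n ↔ τ x = ζ ^ n • x) (τt : P ⊗[k] g →ₗ[k] P ⊗[k] g)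
    (hτt : ∀ f x, τt (f ⊗ₜ x) =
      e.symm ((e f).comp (Polynomial.C ζ⁻¹ * Polynomial.X)) ⊗ₜ τ x) (u : P ⊗[k] g) :
    τt u = u ↔ ∀ n, tcoeff g e n u ∈ gk n := by
  have hcoeff : ∀ n, tcoeff g e n (τt u) = (ζ⁻¹) ^ n • τ (tcoeff g e n u) := by
    intro n
    induction u using TensorProduct.induction_on with
    | zero => simp
    | add u v hu hv => simp [hu, hv]
    | tmul f x =>
      rw [hτt, tcoeff_tmul, tcoeff_tmul, AlgEquiv.apply_symm_apply,
        Polynomial.comp_C_mul_X_coeff, map_smul, smul_smul, mul_comm]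
  constructor
  · intro h n
    have := hcoeff n
    rw [h] at this
    rw [hgk, this, smul_smul, ← mul_pow, mul_inv_cancel₀ hζ, one_pow, one_smul, ← this]
  · intro h
    obtain ⟨N, hN⟩ := exists_eq_sum_X_pow_tmul_tcoeff e u
    rw [hN, map_sum]
    refine Finset.sum_congr rfl fun n _ => ?_
    rw [hτt, (hgk n _).mp (h n), map_pow, AlgEquiv.apply_symm_apply, Polynomial.X_pow_comp,
      mul_pow, ← Polynomial.C_pow, ← Polynomial.smul_eq_C_mul, map_smul, map_pow,
      TensorProduct.smul_tmul, smul_smul, ← mul_pow, inv_mul_cancel₀ hζ, one_pow, one_smul]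

/-- A twisted current algebra on which the centroid acts by scalars modulo `t ^ m` is not an
equivariant map algebra of a free action. -/
theorem false_of_equiv_equivariantMapAlgebra [IsAlgClosed k] [CharZero k] [FiniteDimensional k g]
    [H.IsCartanSubalgebra] (hm2 : 2 ≤ m)
    (hL : ∀ u, u ∈ L ↔ ∀ n, tcoeff g e n u ∈ gk n)
    (hlie : ∀ {i j x y}, x ∈ gk i → y ∈ gk j → ⁅x, y⁆ ∈ gk (i + j))
    (hH0 : ∀ x ∈ H, x ∈ gk 0) (hHk : ∀ n, 0 < n → n < m → ∀ x ∈ H, x ∈ gk n → x = 0)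
    (hperf : ∀ n, gk n ≤ Submodule.span k {z | ∃ x ∈ gk 0, ∃ y ∈ gk n, z = ⁅x, y⁆})
    (hcent : ∀ x ∈ gk 0, (∀ y ∈ gk 1, ⁅y, x⁆ = 0) → x = 0)
    (hne : gk 1 ≠ ⊥) (hne' : gk (m - 1) ≠ ⊥)
    (hirr : ∀ W ≤ gk 1, (∀ x ∈ gk 0, ∀ w ∈ W, ⁅x, w⁆ ∈ W) → W = ⊥ ∨ W = gk 1)
    {a A Γ : Type*} [LieRing a] [LieAlgebra k a] [FiniteDimensional k a]
    [LieAlgebra.IsSemisimple k a] [CommRing A] [Algebra k A] [Algebra.FiniteType k A]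
    [Group Γ] [Finite Γ] (φ : Γ → (a →ₗ⁅k⁆ a)) (ψ : Γ → (A →ₐ[k] A))
    (hφ1 : ∀ x, φ 1 x = x) (hφmul : ∀ (γ δ : Γ) (x : a), φ (γ * δ) x = φ γ (φ δ x))
    (hψ1 : ∀ y, ψ 1 y = y) (hψmul : ∀ (γ δ : Γ) (y : A), ψ (γ * δ) y = ψ γ (ψ δ y))
    (hfree : ∀ (γ : Γ) (M : Ideal A), M.IsMaximal →
      Ideal.comap (ψ γ : A →+* A) M = M → γ = 1)
    (F : Submodule k (A ⊗[k] a))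
    (hF : ∀ z, z ∈ F ↔ ∀ γ, TensorProduct.map (ψ γ).toLinearMap (φ γ).toLinearMap z = z)
    (E : L ≃ₗ[k] F) (hE : ∀ u v, (E ⁅u, v⁆ : A ⊗[k] a) = ⁅(E u : A ⊗[k] a), (E v : A ⊗[k] a)⁆) :
    False := by
  let K : Submodule k L :=
    ⨅ n, ⨅ (_ : n < m), LinearMap.ker (tcoeff g e n ∘ₗ L.toSubmodule.subtype)
  let R : Submodule k L :=
    ⨅ n, ⨅ (_ : n + 1 < m), LinearMap.ker (tcoeff g e n ∘ₗ L.toSubmodule.subtype)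
  have hK : ∀ u : L, u ∈ K ↔ ∀ n < m, tcoeff g e n u = 0 := fun u => by
    simp only [K, Submodule.mem_iInf]; rfl
  have hR : ∀ u : L, u ∈ R ↔ ∀ n, n + 1 < m → tcoeff g e n u = 0 := fun u => by
    simp only [R, Submodule.mem_iInf]; rfl
  have hLR : ∀ u : L, ∀ v ∈ R, ⁅u, v⁆ ∈ R := fun u v hv => (hR _).mpr fun n hn => by
    rw [LieSubalgebra.coe_bracket, tcoeff_lie]
    refine Finset.sum_eq_zero fun p hp => ?_
    rw [Finset.HasAntidiagonal.mem_antidiagonal] at hp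
    rw [(hR v).mp hv p.2 (by omega), lie_zero]
  have hRR : ∀ u ∈ R, ∀ v ∈ R, ⁅u, v⁆ ∈ K := fun u hu v hv => (hK _).mpr fun n hn => by
    rw [LieSubalgebra.coe_bracket, tcoeff_lie]
    refine Finset.sum_eq_zero fun p hp => ?_
    rw [Finset.HasAntidiagonal.mem_antidiagonal] at hp
    by_cases h : p.1 + 1 < m
    · rw [(hR u).mp hu p.1 h, zero_lie]
    · rw [(hR v).mp hv p.2 (by omega), lie_zero]
  have hRK : ¬ R ≤ K := by
    obtain ⟨x, hx, hx0⟩ := (Submodule.ne_bot_iff _).mp hne'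
    have hcoeff : ∀ n, tcoeff g e n ((e.symm Polynomial.X ^ (m - 1)) ⊗ₜ[k] x) =
        if n = m - 1 then x else 0 := fun n => by simp [Polynomial.coeff_X_pow, ite_smul]
    refine fun h => hx0 ?_
    have hmem : (⟨_, X_pow_tmul_mem e hL hx⟩ : L) ∈ R := (hR _).mpr fun n hn => by
      rw [hcoeff, if_neg (by omega)]
    have := (hK _).mp (h hmem) (m - 1) (by omega)
    rwa [hcoeff, if_pos rfl] at this
  let ι : L →ₗ[k] A ⊗[k] a := F.subtype ∘ₗ E.toLinearMap
  have hι : Function.Injective ι := F.subtype_injective.comp E.injective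
  have hιF : ∀ z ∈ F, ∃ u, ι u = z := fun z hz => ⟨E.symm ⟨z, hz⟩, by simp [ι]⟩
  have hιlie : ∀ u v, ι ⁅u, v⁆ = ⁅ι u, ι v⁆ := hE
  have hmapF : ∀ W : Submodule k L, W.map ι ≤ F := fun W => by
    rintro _ ⟨u, -, rfl⟩
    exact (E u).2
  refine hRK ((Submodule.map_le_map_iff_of_injective hι R K).mp ?_)
  refine le_of_lie_mem_of_free_action ψ φ hφ1 hφmul hψ1 hψmul hfree F _ _ hF ?_ (hmapF R) ?_ ?_ ?_
  · refine lt_of_le_not_ge (hmapF K) fun h => hRK ?_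
    exact (Submodule.map_le_map_iff_of_injective hι R K).mp ((hmapF R).trans h)
  · rintro z hz _ ⟨v, hv, rfl⟩
    obtain ⟨u, rfl⟩ := hιF z hz
    exact ⟨⁅u, v⁆, hLR u v hv, hιlie u v⟩
  · rintro _ ⟨u, hu, rfl⟩ _ ⟨v, hv, rfl⟩
    exact ⟨⁅u, v⁆, hRR u hu v hv, hιlie u v⟩
  · intro b hb
    have hbF : ∀ z ∈ F, b • z ∈ F := fun z hz => (hF _).mpr fun γ => by
      have h : ∀ w : A ⊗[k] a, TensorProduct.map (ψ γ).toLinearMap (φ γ).toLinearMap (b • w) =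
          ψ γ b • TensorProduct.map (ψ γ).toLinearMap (φ γ).toLinearMap w := fun w => by
        induction w using TensorProduct.induction_on with
        | zero => simp
        | add u v hu hv => simp only [smul_add, map_add, hu, hv]
        | tmul f x => simp [TensorProduct.smul_tmul']
      rw [h, hb, (hF z).mp hz γ]
    let B : L →ₗ[k] L := E.symm.toLinearMap ∘ₗ
      ((LinearMap.lsmul A (A ⊗[k] a) b).restrictScalars k).restrict hbF ∘ₗ E.toLinearMap
    have hB : ∀ u, ι (B u) = b • ι u := fun u => by simp [ι, B]; rfl
    obtain ⟨c, hc⟩ := exists_tcoeff_centroid_eq_smul e hL hlie hH0 hHk hperf hcent hne hirr B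
      fun u v => hι <| by rw [hB, hιlie, hιlie, hB, smul_lie]
    refine ⟨c, fun z hz => ?_⟩
    obtain ⟨u, rfl⟩ := hιF z hz
    refine ⟨B u - c • u, (hK _).mpr fun n hn => ?_, by rw [map_sub, map_smul, hB]⟩
    simp [hc u n hn]

end TwistedCurrent

/-- Under the stated hypotheses on (g, τ, m) (with g^τ semisimple),
the fixed-point algebra L = (g ⊗ ℂ[t])^τ is not isomorphic, as a Lie algebra over ℂ, to any
equivariant map algebra (a ⊗ A)^Γ with a finite-dimensional semisimple, A a finitely
generated commutative ℂ-algebra, and Γ a finite abelian group acting on a by Lie algebra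
automorphisms and on A by algebra automorphisms so that the induced action on maximal
ideals of A is free. -/
theorem statement13
    {g : Type*} [LieRing g] [LieAlgebra ℂ g] [FiniteDimensional ℂ g]
    (m : ℕ) (hm : 1 ≤ m) (ζ : ℂ) (hζ : IsPrimitiveRoot ζ m)
    (τ : g →ₗ⁅ℂ⁆ g) (hτm : ∀ x, (⇑τ)^[m] x = x)
    (τt : (Polynomial ℂ ⊗[ℂ] g) →ₗ[ℂ] (Polynomial ℂ ⊗[ℂ] g))
    (hτt : ∀ (f : Polynomial ℂ) (x : g),
      τt (f ⊗ₜ[ℂ] x) = (f.comp (Polynomial.C ζ⁻¹ * Polynomial.X)) ⊗ₜ[ℂ] (τ x))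
    (hτtLie : ∀ a b : Polynomial ℂ ⊗[ℂ] g, τt ⁅a, b⁆ = ⁅τt a, τt b⁆)
    (Lfix : Submodule ℂ (Polynomial ℂ ⊗[ℂ] g))
    (hLfix : ∀ a, a ∈ Lfix ↔ τt a = a)
    [LieAlgebra.IsSimple ℂ g] (hm2 : 2 ≤ m)
    (H : LieSubalgebra ℂ g) [H.IsCartanSubalgebra] (hHfix : ∀ x ∈ H, τ x = x)
    (gk : ℕ → Submodule ℂ g) (hgk : ∀ (k : ℕ) (x : g), x ∈ gk k ↔ τ x = ζ ^ k • x)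
    (sb : Submodule ℂ g → Submodule ℂ g → Submodule ℂ g)
    (hsb : ∀ A B : Submodule ℂ g,
      sb A B = Submodule.span ℂ {z : g | ∃ x ∈ A, ∃ y ∈ B, z = ⁅x, y⁆})
    (hspan0 : gk 0 = sb (gk 1) (gk (m - 1)))
    (hspank : ∀ l k : ℕ, l < k → k ≤ m - 1 → gk k = sb (gk (k - l)) (gk l))
    (hirr : ∀ k : ℕ, 1 ≤ k → k ≤ m - 1 →
      gk k ≠ ⊥ ∧
      (∀ W : Submodule ℂ g, W ≤ gk k →
        (∀ x ∈ gk 0, ∀ w ∈ W, ⁅x, w⁆ ∈ W) → W = ⊥ ∨ W = gk k) ∧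
      sb (gk 0) (gk k) = gk k)
    (G0 : LieSubalgebra ℂ g) (hG0 : ∀ x, x ∈ G0 ↔ τ x = x)
    (hG0ss : LieAlgebra.IsSemisimple ℂ G0) :
    ¬ ∃ (a : Type) (_ : LieRing a) (_ : LieAlgebra ℂ a) (_ : FiniteDimensional ℂ a)
        (_ : LieAlgebra.IsSemisimple ℂ a)
        (A : Type) (_ : CommRing A) (_ : Algebra ℂ A) (_ : Algebra.FiniteType ℂ A)
        (Γ : Type) (_ : CommGroup Γ) (_ : Finite Γ)
        (φ : Γ → (a →ₗ⁅ℂ⁆ a)) (ψ : Γ → (A →ₐ[ℂ] A)),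
      (∀ x : a, φ 1 x = x) ∧
      (∀ (γ δ : Γ) (x : a), φ (γ * δ) x = φ γ (φ δ x)) ∧
      (∀ y : A, ψ 1 y = y) ∧
      (∀ (γ δ : Γ) (y : A), ψ (γ * δ) y = ψ γ (ψ δ y)) ∧
      (∀ (γ : Γ) (M : Ideal A), M.IsMaximal →
        Ideal.comap (ψ γ : A →+* A) M = M → γ = 1) ∧
      (∃ F : Submodule ℂ (A ⊗[ℂ] a),
        (∀ z : A ⊗[ℂ] a, z ∈ F ↔
          ∀ γ : Γ, TensorProduct.map (ψ γ).toLinearMap (φ γ).toLinearMap z = z) ∧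
        ∃ e : ↥Lfix ≃ₗ[ℂ] ↥F,
          ∀ u v w : ↥Lfix,
            (w : Polynomial ℂ ⊗[ℂ] g) =
              ⁅(u : Polynomial ℂ ⊗[ℂ] g), (v : Polynomial ℂ ⊗[ℂ] g)⁆ →
            (e w : A ⊗[ℂ] a) = ⁅(e u : A ⊗[ℂ] a), (e v : A ⊗[ℂ] a)⁆) := by
  rintro ⟨a, _, _, _, _, A, _, _, _, Γ, _, _, φ, ψ, hφ1, hφmul, hψ1, hψmul, hfree, F, hF, e, he⟩
  have hζ0 : ζ ≠ 0 := hζ.ne_zero (by omega)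
  have hmem0 : ∀ x, x ∈ gk 0 ↔ τ x = x := fun x => by rw [hgk, pow_zero, one_smul]
  have hG0gk : G0.toSubmodule = gk 0 := Submodule.ext fun x => (hG0 x).trans (hmem0 x).symm
  have hmod : ∀ n, gk (n % m) = gk n := fun n => Submodule.ext fun x => by
    rw [hgk, hgk, ← pow_eq_pow_mod n hζ.pow_eq_one]
  have hlie : ∀ {i j x y}, x ∈ gk i → y ∈ gk j → ⁅x, y⁆ ∈ gk (i + j) := fun {i j x y} hx hy => by
    rw [hgk] at hx hy ⊢
    rw [LieHom.map_lie, hx, hy, smul_lie, lie_smul, smul_smul, pow_add]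
  have hH0 : ∀ x ∈ H, x ∈ gk 0 := fun x hx => (hmem0 x).mpr (hHfix x hx)
  have hHk : ∀ n, 0 < n → n < m → ∀ x ∈ H, x ∈ gk n → x = 0 := fun n hn hnm x hxH hx => by
    rw [hgk, hHfix x hxH] at hx
    have h : (1 - ζ ^ n) • x = 0 := by rw [sub_smul, one_smul, ← hx, sub_self]
    exact (smul_eq_zero.mp h).resolve_left
      (sub_ne_zero.mpr (hζ.pow_ne_one_of_pos_of_lt hn.ne' hnm).symm)
  have hperf : ∀ n, gk n ≤ Submodule.span ℂ {z | ∃ x ∈ gk 0, ∃ y ∈ gk n, z = ⁅x, y⁆} := by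
    intro n
    rw [← hmod n]
    rcases Nat.eq_zero_or_pos (n % m) with h | h
    · rw [h, ← hG0gk]
      exact G0.le_span_lie_of_isSemisimple
    · rw [← hsb, (hirr _ h (Nat.le_sub_one_of_lt (Nat.mod_lt n (by omega)))).2.2]
  have hcent : ∀ x ∈ gk 0, (∀ y ∈ gk 1, ⁅y, x⁆ = 0) → x = 0 := by
    intro x hx hx1
    have hj : ∀ j, j + 1 ≤ m - 1 → ∀ y ∈ gk (j + 1), ⁅y, x⁆ = 0 := by
      intro j
      induction j with
      | zero => exact fun _ => hx1
      | succ j ih =>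
        intro hj y hy
        rw [hspank 1 (j + 1 + 1) (by omega) hj, hsb] at hy
        exact lie_eq_zero_of_mem_span_lie (ih (by omega)) hx1 hy
    have hm1 : ∀ y ∈ gk (m - 1), ⁅y, x⁆ = 0 := by
      obtain ⟨j, hjm⟩ : ∃ j, m - 1 = j + 1 := ⟨m - 2, by omega⟩
      exact hjm ▸ hj j hjm.ge
    refine G0.eq_zero_of_isSemisimple (hG0gk.ge hx) fun y hy => ?_
    have hy0 : y ∈ gk 0 := hG0gk.le hy
    rw [hspan0, hsb] at hy0
    exact lie_eq_zero_of_mem_span_lie hx1 hm1 hy0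
  let L : LieSubalgebra ℂ (Polynomial ℂ ⊗[ℂ] g) :=
    { Lfix with
      lie_mem' := fun {u v} hu hv => (hLfix _).mpr <|
        (hτtLie u v).trans <| congrArg₂ _ ((hLfix u).mp hu) ((hLfix v).mp hv) }
  have hL : ∀ u, u ∈ L ↔ ∀ n, tcoeff g AlgEquiv.refl n u ∈ gk n := fun u => (hLfix u).trans <|
    mem_iff_tcoeff_mem_of_twist AlgEquiv.refl hζ0 τ.toLinearMap hgk τt hτt u
  obtain ⟨hne, hirr1, -⟩ := hirr 1 le_rfl (by omega)
  exact false_of_equiv_equivariantMapAlgebra AlgEquiv.refl hm2 hL hlie hH0 hHk hperf hcent hne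
    (hirr (m - 1) (by omega) le_rfl).1 hirr1 φ ψ hφ1 hφmul hψ1 hψmul hfree F hF e
    fun u v => he u v ⁅u, v⁆ rfl
end

section
/- For every r ≥ 0: ρ(x ⊗ 1)^r ρ(y ⊗ t)^r v = (−1)^r (r!)^2 P_r v, and also ρ(x ⊗ t)^r ρ(y ⊗ 1)^r v = (−1)^r (r!)^2 P_r v. -/
namespace Garland

open PowerSeries Polynomial

/-- The Euler operator `X · d/dX` on power series over a possibly noncommutative ring. -/
noncomputable def euler {R : Type*} [Ring R] (f : PowerSeries R) : PowerSeries R :=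
  PowerSeries.mk fun n => (n : R) * PowerSeries.coeff n f

section Ring

variable {R : Type*} [Ring R]

@[simp] lemma coeff_euler (f : PowerSeries R) (n : ℕ) :
    PowerSeries.coeff n (euler f) = (n : R) * PowerSeries.coeff n f := by
  simp [euler]

lemma euler_one : euler (1 : PowerSeries R) = 0 := by
  ext n
  by_cases h : n = 0 <;> simp [PowerSeries.coeff_one, h]

lemma euler_mul (f g : PowerSeries R) : euler (f * g) = euler f * g + f * euler g := by
  ext n
  simp only [coeff_euler, map_add, PowerSeries.coeff_mul, Finset.mul_sum,
    ← Finset.sum_add_distrib]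
  refine Finset.sum_congr rfl fun p hp => ?_
  rw [← Finset.HasAntidiagonal.mem_antidiagonal.mp hp, Nat.cast_add, add_mul, mul_assoc,
    ← mul_assoc _ (p.2 : R), ← Nat.cast_comm, mul_assoc]

/-- Powers of `y` have the derivative one expects when `y` commutes with its derivative. -/
lemma euler_pow_mul {y z s : PowerSeries R} (hs : ∀ f, s * f = f * s) (hzy : z * y = y * z)
    (hy : euler y = -(s * z)) (k : ℕ) :
    euler (y ^ k) * y = -((k : PowerSeries R) * (s * (y ^ k * z))) := by
  induction k with
  | zero => simp [euler_one]
  | succ k ih =>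
    have h : y ^ k * (s * z) * y = s * (y ^ (k + 1) * z) := by
      rw [← mul_assoc, ← hs, mul_assoc, mul_assoc, hzy, pow_succ, mul_assoc (y ^ k)]
    have h' : (s * (y ^ k * z)) * y = s * (y ^ (k + 1) * z) := by
      rw [mul_assoc, mul_assoc, hzy, pow_succ, mul_assoc (y ^ k)]
    rw [pow_succ, euler_mul, hy, ih, add_mul, neg_mul, mul_assoc _ _ y, h', mul_neg, neg_mul, h,
      ← pow_succ]
    push_cast
    noncomm_ring

/-- Commuting `a` past a power of `y`, when `[a, y] = h` and `[h, y] = -2z`. -/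
lemma mul_pow_succ {a y h z s : PowerSeries R} (hs : ∀ f, s * f = f * s)
    (hzy : z * y = y * z) (hy : euler y = -(s * z)) (hay : a * y = y * a + h)
    (hhy : h * y = y * h - 2 * z) (k : ℕ) :
    s * (a * y ^ (k + 1)) = s * (y ^ (k + 1) * a) +
      ((k + 1 : ℕ) : PowerSeries R) * (s * (y ^ k * h) + euler (y ^ k)) := by
  induction k with
  | zero => simp [euler_one, hay, mul_add]
  | succ k ih =>
    have e := euler_pow_mul hs hzy hy k
    have e1 : s * (y ^ (k + 1) * a) * y = s * (y ^ (k + 2) * a) + s * (y ^ (k + 1) * h) := by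
      rw [mul_assoc, mul_assoc, hay, mul_add, mul_add, ← mul_assoc _ y a, ← pow_succ]
    have e2 : s * (y ^ k * h) * y = s * (y ^ (k + 1) * h) - 2 * (s * (y ^ k * z)) := by
      rw [mul_assoc, mul_assoc, hhy, mul_sub, mul_sub, ← mul_assoc _ y h, ← pow_succ]
      noncomm_ring
    have e3 : euler (y ^ (k + 1)) = -(((k + 1 : ℕ) : PowerSeries R) * (s * (y ^ k * z))) := by
      rw [pow_succ, euler_mul, hy, e, mul_neg, ← mul_assoc (y ^ k) s, ← hs (y ^ k), mul_assoc s]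
      push_cast
      noncomm_ring
    calc s * (a * y ^ (k + 1 + 1)) = s * (a * y ^ (k + 1)) * y := by
          rw [pow_succ y (k + 1)]; simp only [mul_assoc]
      _ = _ := by
          rw [ih, add_mul, e1, mul_assoc, add_mul, e2, e, e3]
          push_cast
          noncomm_ring

end Ring

section Module

variable {V : Type*} [AddCommGroup V] [Module ℂ V]

/-- Garland's identity for `x ⊗ p` and `y ⊗ q` with `p q = t`. -/
theorem pow_mul_pow_apply (ρx ρy ρh : ℂ[X] →ₗ[ℂ] Module.End ℂ V)
    (hxy : ∀ f g, ρx f * ρy g - ρy g * ρx f = ρh (f * g))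
    (hhx : ∀ f g, ρh f * ρx g - ρx g * ρh f = (2 : ℂ) • ρx (f * g))
    (hhy : ∀ f g, ρh f * ρy g - ρy g * ρh f = -((2 : ℂ) • ρy (f * g)))
    (hyy : ∀ f g, ρy f * ρy g = ρy g * ρy f)
    (v : V) (hv : ∀ f, ρx f v = 0) (P : ℕ → Module.End ℂ V) (hP0 : P 0 = 1)
    (hPrec : ∀ r : ℕ, 1 ≤ r →
      (r : ℂ) • P r = -∑ p ∈ Finset.Icc 1 r, ρh (Polynomial.X ^ p) * P (r - p))
    (p q : ℂ[X]) (hpq : p * q = Polynomial.X) (r : ℕ) :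
    (ρx p ^ r * ρy q ^ r) v = ((-1 : ℂ) ^ r * (r.factorial : ℂ) ^ 2) • P r v := by
  let T : ℂ[X] := Polynomial.X
  let s : PowerSeries (Module.End ℂ V) := PowerSeries.X
  let a : PowerSeries (Module.End ℂ V) := PowerSeries.C (ρx p)
  let y : PowerSeries (Module.End ℂ V) := PowerSeries.mk fun n => ρy (q * (-T) ^ n)
  let h : PowerSeries (Module.End ℂ V) := PowerSeries.mk fun n => ρh (T * (-T) ^ n)
  let z : PowerSeries (Module.End ℂ V) := PowerSeries.mk fun n =>
    ((n + 1 : ℕ) : Module.End ℂ V) * ρy (q * T * (-T) ^ n)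
  let L : PowerSeries (Module.End ℂ V) := PowerSeries.mk fun n => (-1 : ℂ) ^ n • P n
  have hs : ∀ f, s * f = f * s := fun f => (PowerSeries.commute_X f).symm.eq
  have hzy : z * y = y * z := by
    ext1 n
    rw [PowerSeries.coeff_mul, PowerSeries.coeff_mul, ← Finset.Nat.sum_antidiagonal_swap]
    refine Finset.sum_congr rfl fun i _ => ?_
    simp only [z, y, PowerSeries.coeff_mk, Prod.fst_swap, Prod.snd_swap]
    rw [mul_assoc, hyy, ← mul_assoc, Nat.cast_comm, mul_assoc]
  have hy : euler y = -(s * z) := by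
    ext1 n
    cases n with
    | zero => simp [s]
    | succ n =>
      simp only [s, coeff_euler, map_neg, PowerSeries.coeff_succ_X_mul, y, z,
        PowerSeries.coeff_mk]
      rw [← mul_neg, ← map_neg]
      congr 2
      ring
  have hay : a * y = y * a + h := by
    ext1 n
    simp only [a, y, h, map_add, PowerSeries.coeff_C_mul, PowerSeries.coeff_mul_C,
      PowerSeries.coeff_mk]
    rw [← sub_eq_iff_eq_add', hxy, ← mul_assoc, hpq]
  have hhy' : h * y = y * h - 2 * z := by
    ext1 n
    have h2 : (2 : PowerSeries (Module.End ℂ V)) * z = z + z := two_mul z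
    have hc : PowerSeries.coeff n (h * y) - PowerSeries.coeff n (y * h) =
        -(PowerSeries.coeff n z + PowerSeries.coeff n z) := by
      rw [PowerSeries.coeff_mul, PowerSeries.coeff_mul,
        ← Finset.Nat.sum_antidiagonal_swap (f := fun i : ℕ × ℕ =>
          PowerSeries.coeff i.1 y * PowerSeries.coeff i.2 h), ← Finset.sum_sub_distrib]
      have hterm : ∀ i ∈ Finset.HasAntidiagonal.antidiagonal n,
          PowerSeries.coeff i.1 h * PowerSeries.coeff i.2 y -
            PowerSeries.coeff i.swap.1 y * PowerSeries.coeff i.swap.2 h =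
          -((2 : ℂ) • ρy (q * T * (-T) ^ n)) := by
        intro i hi
        simp only [h, y, PowerSeries.coeff_mk, Prod.fst_swap, Prod.snd_swap]
        rw [hhy, ← Finset.HasAntidiagonal.mem_antidiagonal.mp hi]
        congr 3
        ring
      rw [Finset.sum_congr rfl hterm]
      simp only [z, PowerSeries.coeff_mk, Finset.sum_const, Finset.Nat.card_antidiagonal,
        nsmul_eq_mul, two_smul, mul_neg, mul_add]
    rw [h2, map_sub, map_add, sub_eq_add_neg, ← hc, add_sub_cancel]
  have hL : euler L = s * (h * L) := by
    ext1 n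
    cases n with
    | zero => simp [s]
    | succ n =>
      simp only [s, coeff_euler, PowerSeries.coeff_succ_X_mul]
      simp only [PowerSeries.coeff_mul, h, L, PowerSeries.coeff_mk]
      rw [Finset.Nat.sum_antidiagonal_eq_sum_range_succ_mk, ← nsmul_eq_mul, smul_comm,
        ← Nat.cast_smul_eq_nsmul ℂ, hPrec _ n.succ_pos, ← Finset.Ico_add_one_right_eq_Icc,
        Finset.sum_Ico_eq_sum_range, pow_succ, mul_neg_one, neg_smul, smul_neg, neg_neg,
        Finset.smul_sum]
      refine Finset.sum_congr rfl fun i hi => ?_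
      have hin : i ≤ n := Nat.lt_succ_iff.mp (Finset.mem_range.mp hi)
      have hT : T * (-T) ^ i = (-1 : ℂ) ^ i • Polynomial.X ^ (1 + i) := by
        rw [neg_pow, pow_add, pow_one, Polynomial.smul_eq_C_mul]
        simp only [map_pow, map_neg, map_one, T]
        ring
      rw [hT, map_smul, smul_mul_smul_comm, ← pow_add, Nat.add_sub_of_le hin,
        show n + 1 - (1 + i) = n - i by omega]
  have hprim : ∀ n f, ρx f (P n v) = 0 := by
    intro n
    induction n using Nat.strong_induction_on with
    | _ n ih =>
      intro f
      rcases Nat.eq_zero_or_pos n with rfl | hn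
      · simp [hP0, hv]
      · have hn' : (n : ℂ) ≠ 0 := Nat.cast_ne_zero.mpr hn.ne'
        refine (smul_eq_zero.mp ?_).resolve_left hn'
        rw [← map_smul, ← LinearMap.smul_apply, hPrec n hn, LinearMap.neg_apply, map_neg,
          LinearMap.sum_apply, map_sum, neg_eq_zero]
        refine Finset.sum_eq_zero fun i hi => ?_
        have hlt : n - i < n := by have := Finset.mem_Icc.mp hi; omega
        have := LinearMap.congr_fun (hhx (Polynomial.X ^ i) f) (P (n - i) v)
        simpa [ih _ hlt] using this
  have step : ∀ k n, ρx p ((PowerSeries.coeff n (y ^ (k + 1) * L) : Module.End ℂ V) v) =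
      (((k + 1) * (n + 1) : ℕ) : ℂ) •
        (PowerSeries.coeff (n + 1) (y ^ k * L) : Module.End ℂ V) v := by
    intro k n
    have hid : s * (a * (y ^ (k + 1) * L)) =
        s * (y ^ (k + 1) * (a * L)) + (k + 1) • euler (y ^ k * L) := by
      have := congrArg (· * L) (mul_pow_succ hs hzy hy hay hhy' k)
      simp only [add_mul, mul_assoc] at this
      rw [this, nsmul_eq_mul, euler_mul, hL, ← mul_assoc (y ^ k) s, ← hs, mul_assoc s,
        add_comm (euler _ * L)]
    have hc := LinearMap.congr_fun (congrArg (PowerSeries.coeff (n + 1)) hid) v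
    have h0 : (PowerSeries.coeff n (y ^ (k + 1) * (a * L)) : Module.End ℂ V) v = 0 := by
      rw [PowerSeries.coeff_mul, LinearMap.sum_apply]
      refine Finset.sum_eq_zero fun i _ => ?_
      simp [a, L, hprim]
    rw [map_add, map_nsmul, coeff_euler, LinearMap.add_apply] at hc
    simp only [s, PowerSeries.coeff_succ_X_mul] at hc
    rw [h0, zero_add] at hc
    simp only [a, PowerSeries.coeff_C_mul, Module.End.mul_apply] at hc
    rw [hc, ← nsmul_eq_mul, smul_smul, LinearMap.smul_apply, Nat.cast_smul_eq_nsmul]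
  have key : ∀ m k, (k.factorial : ℂ) • (ρx p ^ m * ρy q ^ (m + k)) v =
      ((m.factorial * (m + k).factorial : ℕ) : ℂ) •
        (PowerSeries.coeff m (y ^ k * L) : Module.End ℂ V) v := by
    intro m
    induction m with
    | zero =>
      intro k
      simp [y, L, hP0]
    | succ m ih =>
      intro k
      have hk : ((k : ℂ) + 1) ≠ 0 := Nat.cast_add_one_ne_zero k
      have := congrArg (ρx p) (ih (k + 1))
      rw [map_smul, map_smul, step, smul_smul] at this
      have e : m + 1 + k = m + (k + 1) := by ring
      refine smul_right_injective V hk ?_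
      simp only [smul_smul]
      rw [e, pow_succ', mul_assoc, Module.End.mul_apply (ρx p)]
      convert this using 2
      · rw [Nat.factorial_succ]; push_cast; ring
      · rw [Nat.factorial_succ m]; push_cast; ring
  have := key r 0
  simpa [L, smul_smul, pow_two, mul_comm, mul_assoc, mul_left_comm] using this

end Module

end Garland


/-- (Garland's identity.)  For a representation ρ of sl₂(ℂ[t]) on V, given
by the operators ρx f = ρ(x ⊗ f), ρy f = ρ(y ⊗ f), ρh f = ρ(h ⊗ f), a vector v with
ρ(x ⊗ tʳ)v = 0 for all r, and the operators P_r defined by P_0 = id and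
r·P_r = −Σ_{p=1}^r ρ(h ⊗ tᵖ) P_{r−p}, one has, for every r ≥ 0,
ρ(x⊗1)^r ρ(y⊗t)^r v = (−1)^r (r!)² P_r v and ρ(x⊗t)^r ρ(y⊗1)^r v = (−1)^r (r!)² P_r v. -/
theorem statement14
    {V : Type*} [AddCommGroup V] [Module ℂ V]
    (ρx ρy ρh : Polynomial ℂ → Module.End ℂ V)
    (hxadd : ∀ f g : Polynomial ℂ, ρx (f + g) = ρx f + ρx g)
    (hyadd : ∀ f g : Polynomial ℂ, ρy (f + g) = ρy f + ρy g)
    (hhadd : ∀ f g : Polynomial ℂ, ρh (f + g) = ρh f + ρh g)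
    (hxsmul : ∀ (z : ℂ) (f : Polynomial ℂ), ρx (z • f) = z • ρx f)
    (hysmul : ∀ (z : ℂ) (f : Polynomial ℂ), ρy (z • f) = z • ρy f)
    (hhsmul : ∀ (z : ℂ) (f : Polynomial ℂ), ρh (z • f) = z • ρh f)
    (hxy : ∀ f g : Polynomial ℂ, ρx f * ρy g - ρy g * ρx f = ρh (f * g))
    (hhx : ∀ f g : Polynomial ℂ, ρh f * ρx g - ρx g * ρh f = (2 : ℂ) • ρx (f * g))
    (hhy : ∀ f g : Polynomial ℂ, ρh f * ρy g - ρy g * ρh f = -((2 : ℂ) • ρy (f * g)))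
    (hxx : ∀ f g : Polynomial ℂ, ρx f * ρx g = ρx g * ρx f)
    (hyy : ∀ f g : Polynomial ℂ, ρy f * ρy g = ρy g * ρy f)
    (hhh : ∀ f g : Polynomial ℂ, ρh f * ρh g = ρh g * ρh f)
    (v : V) (hv : ∀ r : ℕ, ρx (Polynomial.X ^ r) v = 0)
    (P : ℕ → Module.End ℂ V)
    (hP0 : P 0 = 1)
    (hPrec : ∀ r : ℕ, 1 ≤ r →
      (r : ℂ) • P r = -∑ p ∈ Finset.Icc 1 r, ρh (Polynomial.X ^ p) * P (r - p))
    : ∀ r : ℕ,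
      ((ρx 1) ^ r * (ρy Polynomial.X) ^ r) v
        = ((-1 : ℂ) ^ r * (r.factorial : ℂ) ^ 2) • (P r v) ∧
      ((ρx Polynomial.X) ^ r * (ρy 1) ^ r) v
        = ((-1 : ℂ) ^ r * (r.factorial : ℂ) ^ 2) • (P r v) := by
  intro r
  let x' : Polynomial ℂ →ₗ[ℂ] Module.End ℂ V := ⟨⟨ρx, hxadd⟩, hxsmul⟩
  let y' : Polynomial ℂ →ₗ[ℂ] Module.End ℂ V := ⟨⟨ρy, hyadd⟩, hysmul⟩
  let h' : Polynomial ℂ →ₗ[ℂ] Module.End ℂ V := ⟨⟨ρh, hhadd⟩, hhsmul⟩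
  have hv' : ∀ f, x' f v = 0 := by
    intro f
    induction f using Polynomial.induction_on' with
    | add f g hf hg => rw [map_add, LinearMap.add_apply, hf, hg, add_zero]
    | monomial n c =>
      rw [← Polynomial.C_mul_X_pow_eq_monomial, ← Polynomial.smul_eq_C_mul, map_smul,
        LinearMap.smul_apply]
      exact (congrArg (c • ·) (hv n)).trans (smul_zero c)
  exact ⟨Garland.pow_mul_pow_apply x' y' h' hxy hhx hhy hyy v hv' P hP0 hPrec
      1 Polynomial.X (one_mul _) r,
    Garland.pow_mul_pow_apply x' y' h' hxy hhx hhy hyy v hv' P hP0 hPrec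
      Polynomial.X 1 (mul_one _) r⟩
end

section
/- For every r ≥ 0: ρ(x ⊗ 1)^r ρ(y ⊗ t)^{r+1} v = (−1)^r r! (r+1)! Σ_{s=0}^r ρ(y ⊗ t^{s+1}) P_{r−s} v. -/
open Finset

/-- If `h a - a h = c` and `c` commutes with `a`, then `h a^(n+1) = a^(n+1) h + (n+1) c a^n`. -/
theorem mul_pow_succ_of_commutator {R : Type*} [Ring R] [Algebra ℂ R] {h a c : R}
    (hac : h * a - a * h = c) (hc : c * a = a * c) (n : ℕ) :
    h * a ^ (n + 1) = a ^ (n + 1) * h + ((n : ℂ) + 1) • (c * a ^ n) := by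
  have e : h * a = a * h + c := by rw [← hac]; abel
  have hcp : ∀ m : ℕ, c * a ^ m = a ^ m * c := fun m => (Commute.pow_right hc m : Commute _ _)
  induction n with
  | zero => simp [e]
  | succ n ih =>
    rw [pow_succ a (n + 1), ← mul_assoc, ih, add_mul, mul_assoc, e, mul_add, smul_mul_assoc,
      mul_assoc c, ← pow_succ, ← hcp, ← mul_assoc]
    push_cast
    module

/-- The divided power `a^n / n!`. -/
noncomputable def dividedPow {R : Type*} [Ring R] [Algebra ℂ R] (a : R) (n : ℕ) : R :=
  ((n.factorial : ℂ)⁻¹) • a ^ n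

section DividedPow

variable {R : Type*} [Ring R] [Algebra ℂ R]

@[simp] theorem dividedPow_zero (a : R) : dividedPow a 0 = 1 := by simp [dividedPow]

theorem mul_dividedPow (a : R) (n : ℕ) :
    a * dividedPow a n = ((n : ℂ) + 1) • dividedPow a (n + 1) := by
  have h1 : ((n : ℂ) + 1) ≠ 0 := Nat.cast_add_one_ne_zero n
  rw [dividedPow, dividedPow, mul_smul_comm, ← pow_succ', smul_smul, Nat.factorial_succ]
  push_cast
  rw [mul_inv, mul_inv_cancel_left₀ h1]

theorem mul_dividedPow_succ_of_commutator {h a c : R}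
    (hac : h * a - a * h = c) (hc : c * a = a * c) (n : ℕ) :
    h * dividedPow a (n + 1) = dividedPow a (n + 1) * h + c * dividedPow a n := by
  have h1 : ((n : ℂ) + 1) ≠ 0 := Nat.cast_add_one_ne_zero n
  rw [dividedPow, dividedPow, mul_smul_comm, mul_pow_succ_of_commutator hac hc, smul_mul_assoc,
    mul_smul_comm, smul_add, smul_smul, Nat.factorial_succ]
  push_cast
  rw [mul_inv_rev, mul_assoc, inv_mul_cancel₀ h1, mul_one]

/-- If `[x, y] = h`, `[h, x] = 2c` and `c` commutes with `x`, then the commutator of a divided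
power of `x` with `y` is the symmetrized product of `h` with the preceding divided power. -/
theorem dividedPow_succ_mul {x y h c : R} (hxy : x * y - y * x = h)
    (hhx : h * x - x * h = (2 : ℂ) • c) (hc : c * x = x * c) (n : ℕ) :
    dividedPow x (n + 1) * y = y * dividedPow x (n + 1)
      + (2⁻¹ : ℂ) • (h * dividedPow x n + dividedPow x n * h) := by
  have key : ∀ n : ℕ, x ^ (n + 1) * y = y * x ^ (n + 1)
      + (((n : ℂ) + 1) * 2⁻¹) • (h * x ^ n + x ^ n * h) := by
    intro n
    have e : x * y = y * x + h := by rw [← hxy]; abel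
    have e' : x * h = h * x - (2 : ℂ) • c := by rw [← hhx]; abel
    induction n with
    | zero =>
      simp only [zero_add, pow_one, pow_zero, mul_one, one_mul, Nat.cast_zero, e]
      module
    | succ n ih =>
      have hp := mul_pow_succ_of_commutator hhx (by rw [smul_mul_assoc, mul_smul_comm, hc]) n
      rw [pow_succ' x (n + 1), mul_assoc, ih, mul_add, ← mul_assoc, e, mul_smul_comm, mul_add,
        ← mul_assoc x h, e', ← mul_assoc x (x ^ n), ← pow_succ', add_mul, sub_mul, mul_assoc h,
        ← pow_succ', mul_assoc y, ← pow_succ', hp]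
      push_cast
      simp only [smul_mul_assoc]
      module
  have h1 : ((n : ℂ) + 1) ≠ 0 := Nat.cast_add_one_ne_zero n
  have h2 : ((n.factorial : ℕ) : ℂ) ≠ 0 := Nat.cast_ne_zero.2 n.factorial_ne_zero
  have h3 : (((n + 1).factorial : ℂ)⁻¹) * (((n : ℂ) + 1) * 2⁻¹) = 2⁻¹ * (n.factorial : ℂ)⁻¹ := by
    rw [Nat.factorial_succ]
    push_cast
    field_simp
  rw [dividedPow, dividedPow, smul_mul_assoc, key, smul_add, smul_smul, h3, mul_smul_comm,
    mul_smul_comm, smul_mul_assoc, ← smul_add, smul_smul]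

end DividedPow

/-- The defining relations of `sl₂(ℂ[t])` for operators `x i`, `y i`, `h i` standing for the
actions of `x ⊗ t^i`, `y ⊗ t^i`, `h ⊗ t^i`. -/
structure CurrentRelations {V : Type*} [AddCommGroup V] [Module ℂ V]
    (x y h : ℕ → Module.End ℂ V) : Prop where
  xy : ∀ i j, x i * y j - y j * x i = h (i + j)
  hx : ∀ i j, h i * x j - x j * h i = (2 : ℂ) • x (i + j)
  hy : ∀ i j, h i * y j - y j * h i = -((2 : ℂ) • y (i + j))
  xx : ∀ i j, x i * x j = x j * x i
  yy : ∀ i j, y i * y j = y j * y i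
  hh : ∀ i j, h i * h j = h j * h i

namespace CurrentRelations

variable {V : Type*} [AddCommGroup V] [Module ℂ V] {x y h : ℕ → Module.End ℂ V}

theorem x_h_apply_eq_zero (H : CurrentRelations x y h) {v : V} (hv : ∀ i, x i v = 0) (k i : ℕ) :
    x i (h k v) = 0 := by
  have e := congrArg (fun T : Module.End ℂ V => T v) (H.hx k i)
  simpa [hv] using e

variable {P : ℕ → Module.End ℂ V}

theorem x_P_apply_eq_zero (H : CurrentRelations x y h) (hP0 : P 0 = 1)
    (hP : ∀ r : ℕ, ((r : ℂ) + 1) • P (r + 1) = -∑ p ∈ range (r + 1), h (p + 1) * P (r - p))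
    {v : V} (hv : ∀ i, x i v = 0) (r i : ℕ) : x i (P r v) = 0 := by
  induction r using Nat.strong_induction_on generalizing i with
  | _ r ih =>
    cases r with
    | zero => simpa [hP0] using hv i
    | succ r =>
      have h1 : ((r : ℂ) + 1) ≠ 0 := Nat.cast_add_one_ne_zero r
      have e := congrArg (fun T : Module.End ℂ V => x i (T v)) (hP r)
      have e0 : ∑ p ∈ range (r + 1), x i (h (p + 1) (P (r - p) v)) = 0 :=
        sum_eq_zero fun p _ => H.x_h_apply_eq_zero (fun j => ih _ (by omega) j) _ _
      simp only [LinearMap.smul_apply, map_smul, LinearMap.neg_apply, map_neg,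
        LinearMap.sum_apply, map_sum, Module.End.mul_apply, e0, neg_zero] at e
      exact (smul_eq_zero.1 e).resolve_left h1

theorem P_mul_h (H : CurrentRelations x y h) (hP0 : P 0 = 1)
    (hP : ∀ r : ℕ, ((r : ℂ) + 1) • P (r + 1) = -∑ p ∈ range (r + 1), h (p + 1) * P (r - p))
    (r k : ℕ) : P r * h k = h k * P r := by
  induction r using Nat.strong_induction_on with
  | _ r ih =>
    cases r with
    | zero => simp [hP0]
    | succ r =>
      have h1 : ((r : ℂ) + 1) ≠ 0 := Nat.cast_add_one_ne_zero r
      have e : ((r : ℂ) + 1) • (P (r + 1) * h k) = ((r : ℂ) + 1) • (h k * P (r + 1)) := by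
        rw [← smul_mul_assoc, ← mul_smul_comm, hP, neg_mul, mul_neg, sum_mul, mul_sum]
        refine congrArg _ (sum_congr rfl fun p _ => ?_)
        rw [mul_assoc, ih _ (by omega), ← mul_assoc, H.hh, mul_assoc]
      exact smul_right_injective _ h1 e

theorem dividedPow_y_dividedPow_succ_apply (H : CurrentRelations x y h) (k r : ℕ) (v : V) :
    dividedPow (x 0) (r + 1) (y k (dividedPow (y 1) (r + 1) v)) =
      y k (dividedPow (x 0) (r + 1) (dividedPow (y 1) (r + 1) v))
      + (2⁻¹ : ℂ) • (h k (dividedPow (x 0) r (dividedPow (y 1) (r + 1) v))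
        + dividedPow (x 0) r (dividedPow (y 1) (r + 1) (h k v)))
      - dividedPow (x 0) r (y (k + 1) (dividedPow (y 1) r v)) := by
  have e1 := dividedPow_succ_mul (h := h k) (c := x k) (by simpa using H.xy 0 k)
    (by simpa using H.hx k 0) (H.xx k 0) r
  have e2 := mul_dividedPow_succ_of_commutator (H.hy k 1)
    (by rw [neg_mul, mul_neg, smul_mul_assoc, mul_smul_comm, H.yy]) r
  have e1' := congrArg (fun T : Module.End ℂ V => T (dividedPow (y 1) (r + 1) v)) e1
  have e2' := congrArg (fun T : Module.End ℂ V => T v) e2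
  simp only [Module.End.mul_apply, LinearMap.add_apply, LinearMap.smul_apply, LinearMap.neg_apply,
    neg_mul, smul_mul_assoc] at e1' e2'
  rw [e1', e2']
  simp only [map_add, map_neg, map_smul]
  module

theorem sum_y_P_h_apply (H : CurrentRelations x y h) (hP0 : P 0 = 1)
    (hP : ∀ r : ℕ, ((r : ℂ) + 1) • P (r + 1) = -∑ p ∈ range (r + 1), h (p + 1) * P (r - p))
    (r : ℕ) (v : V) :
    ∑ j ∈ range r, ∑ s ∈ range (r - j), y (s + 1) (P (r - 1 - j - s) (h (1 + j) v)) =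
      -∑ s ∈ range (r + 1), ((r : ℂ) - s) • y (s + 1) (P (r - s) v) := by
  rw [sum_comm' (t' := range r) (s' := fun s => range (r - s))
    (by intro a b; simp only [mem_range]; omega), sum_range_succ, sub_self, zero_smul, add_zero,
    ← sum_neg_distrib]
  refine sum_congr rfl fun s hs => ?_
  obtain ⟨m, rfl⟩ : ∃ m, r = s + (m + 1) := ⟨r - s - 1, by have := mem_range.1 hs; omega⟩
  have e := congrArg (fun T : Module.End ℂ V => y (s + 1) (T v)) (hP m)
  simp only [LinearMap.smul_apply, map_smul, LinearMap.neg_apply, map_neg,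
    LinearMap.sum_apply, map_sum, Module.End.mul_apply] at e
  have e' : ((s + (m + 1) : ℕ) : ℂ) - s = (m : ℂ) + 1 := by push_cast; ring
  rw [e', Nat.add_sub_cancel_left, e, neg_neg]
  refine sum_congr rfl fun p _ => ?_
  have e3 : s + (m + 1) - 1 - p - s = m - p := by omega
  rw [e3, add_comm 1 p, ← Module.End.mul_apply (P _), H.P_mul_h hP0 hP, Module.End.mul_apply]

/-- Garland's identity follows from the formula for `x₀^(r) y₁ y₁^(r) v`. -/
theorem garland_of_shifted (H : CurrentRelations x y h) (hP0 : P 0 = 1)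
    (hP : ∀ r : ℕ, ((r : ℂ) + 1) • P (r + 1) = -∑ p ∈ range (r + 1), h (p + 1) * P (r - p))
    {r : ℕ} {v : V}
    (hG : dividedPow (x 0) r (y 1 (dividedPow (y 1) r v)) =
      (-1 : ℂ) ^ r • (∑ s ∈ range (r + 1), ((s : ℂ) + 1) • y (1 + s) (P (r - s) v)
        - ∑ j ∈ range r, ∑ s ∈ range (r - j), y (s + 1) (P (r - 1 - j - s) (h (1 + j) v)))) :
    dividedPow (x 0) r (dividedPow (y 1) (r + 1) v) =
      (-1 : ℂ) ^ r • ∑ s ∈ range (r + 1), y (s + 1) (P (r - s) v) := by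
  refine (smul_right_inj (Nat.cast_add_one_ne_zero (R := ℂ) r)).1 ?_
  have e := congrArg (fun T : Module.End ℂ V => T v) (mul_dividedPow (y 1) r)
  simp only [Module.End.mul_apply, LinearMap.smul_apply] at e
  rw [← map_smul, ← e, hG, H.sum_y_P_h_apply hP0 hP, sub_neg_eq_add, ← sum_add_distrib,
    smul_comm, smul_sum (r := (r : ℂ) + 1)]
  refine congrArg _ (sum_congr rfl fun s _ => ?_)
  rw [add_comm 1 s]
  module

theorem dividedPow_succ_dividedPow_succ_apply (H : CurrentRelations x y h) (hP0 : P 0 = 1)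
    (hP : ∀ r : ℕ, ((r : ℂ) + 1) • P (r + 1) = -∑ p ∈ range (r + 1), h (p + 1) * P (r - p))
    {r : ℕ} {v : V} (hv : ∀ i, x i v = 0)
    (hD : dividedPow (x 0) r (dividedPow (y 1) (r + 1) v) =
      (-1 : ℂ) ^ r • ∑ s ∈ range (r + 1), y (s + 1) (P (r - s) v)) :
    dividedPow (x 0) (r + 1) (dividedPow (y 1) (r + 1) v) = (-1 : ℂ) ^ (r + 1) • P (r + 1) v := by
  refine (smul_right_inj (Nat.cast_add_one_ne_zero (R := ℂ) r)).1 ?_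
  have e := congrArg (fun T : Module.End ℂ V => T (dividedPow (y 1) (r + 1) v))
    (mul_dividedPow (x 0) r)
  have e2 := congrArg (fun T : Module.End ℂ V => T v) (hP r)
  simp only [Module.End.mul_apply, LinearMap.smul_apply, LinearMap.neg_apply,
    LinearMap.sum_apply] at e e2
  rw [← e, hD, smul_comm, e2, map_smul, map_sum, pow_succ, mul_neg_one, neg_smul, smul_neg,
    neg_neg]
  refine congrArg _ (sum_congr rfl fun s _ => ?_)
  have e3 := congrArg (fun T : Module.End ℂ V => T (P (r - s) v)) (H.xy 0 (s + 1))
  simpa [H.x_P_apply_eq_zero hP0 hP hv] using e3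

theorem dividedPow_y_dividedPow_apply (H : CurrentRelations x y h) (hP0 : P 0 = 1)
    (hP : ∀ r : ℕ, ((r : ℂ) + 1) • P (r + 1) = -∑ p ∈ range (r + 1), h (p + 1) * P (r - p))
    (r : ℕ) {v : V} (hv : ∀ i, x i v = 0) (k : ℕ) :
    dividedPow (x 0) r (y k (dividedPow (y 1) r v)) =
      (-1 : ℂ) ^ r • (∑ s ∈ range (r + 1), ((s : ℂ) + 1) • y (k + s) (P (r - s) v)
        - ∑ j ∈ range r, ∑ s ∈ range (r - j), y (s + 1) (P (r - 1 - j - s) (h (k + j) v))) := by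
  induction r generalizing v k with
  | zero => simp [hP0]
  | succ r ih =>
    have hD : ∀ {w : V}, (∀ i, x i w = 0) → _ :=
      fun {w} hw => H.garland_of_shifted hP0 hP (ih hw 1)
    have hh : h k (∑ s ∈ range (r + 1), y (s + 1) (P (r - s) v)) =
        ∑ s ∈ range (r + 1), y (s + 1) (P (r - s) (h k v))
          - (2 : ℂ) • ∑ s ∈ range (r + 1), y (k + (s + 1)) (P (r - s) v) := by
      rw [map_sum, smul_sum, ← sum_sub_distrib]
      refine sum_congr rfl fun s _ => ?_
      have e := congrArg (fun T : Module.End ℂ V => T (P (r - s) v)) (H.hy k (s + 1))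
      simp only [Module.End.mul_apply, LinearMap.sub_apply, LinearMap.neg_apply,
        LinearMap.smul_apply] at e
      rw [← Module.End.mul_apply (P _), H.P_mul_h hP0 hP, Module.End.mul_apply,
        sub_eq_iff_eq_add.1 e]
      abel
    have h1 : ∑ s ∈ range (r + 1 + 1), ((s : ℂ) + 1) • y (k + s) (P (r + 1 - s) v) =
        ∑ s ∈ range (r + 1), ((s : ℂ) + 1) • y (k + 1 + s) (P (r - s) v)
          + ∑ s ∈ range (r + 1), y (k + (s + 1)) (P (r - s) v) + y k (P (r + 1) v) := by
      rw [sum_range_succ', ← sum_add_distrib]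
      congr 1
      · refine sum_congr rfl fun s _ => ?_
        rw [Nat.add_sub_add_right, add_right_comm k 1 s, add_assoc k s 1]
        push_cast
        module
      · simp
    have h2 : ∑ j ∈ range (r + 1), ∑ s ∈ range (r + 1 - j),
          y (s + 1) (P (r + 1 - 1 - j - s) (h (k + j) v)) =
        ∑ j ∈ range r, ∑ s ∈ range (r - j), y (s + 1) (P (r - 1 - j - s) (h (k + 1 + j) v))
          + ∑ s ∈ range (r + 1), y (s + 1) (P (r - s) (h k v)) := by
      rw [sum_range_succ']
      congr 1
      refine sum_congr rfl fun j _ => ?_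
      rw [Nat.add_sub_add_right]
      refine sum_congr rfl fun s _ => ?_
      rw [add_right_comm k 1 j, add_assoc k j 1, Nat.add_sub_cancel, Nat.sub_sub r 1 j,
        add_comm 1 j]
    rw [H.dividedPow_y_dividedPow_succ_apply,
      H.dividedPow_succ_dividedPow_succ_apply hP0 hP hv (hD hv), hD hv,
      hD (H.x_h_apply_eq_zero hv k), ih hv (k + 1), map_smul, map_smul, hh, h1, h2, pow_succ]
    module

/-- Garland's identity in terms of divided powers. -/
theorem garland (H : CurrentRelations x y h) (hP0 : P 0 = 1)
    (hP : ∀ r : ℕ, ((r : ℂ) + 1) • P (r + 1) = -∑ p ∈ range (r + 1), h (p + 1) * P (r - p))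
    (r : ℕ) {v : V} (hv : ∀ i, x i v = 0) :
    dividedPow (x 0) r (dividedPow (y 1) (r + 1) v) =
      (-1 : ℂ) ^ r • ∑ s ∈ range (r + 1), y (s + 1) (P (r - s) v) :=
  H.garland_of_shifted hP0 hP (H.dividedPow_y_dividedPow_apply hP0 hP r hv 1)

end CurrentRelations


/-- (Garland's identity.)  In the setting of Statement 14, for every r ≥ 0,
ρ(x⊗1)^r ρ(y⊗t)^{r+1} v = (−1)^r r! (r+1)! Σ_{s=0}^r ρ(y ⊗ t^{s+1}) P_{r−s} v. -/
theorem statement15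
    {V : Type*} [AddCommGroup V] [Module ℂ V]
    (ρx ρy ρh : Polynomial ℂ → Module.End ℂ V)
    (hxadd : ∀ f g : Polynomial ℂ, ρx (f + g) = ρx f + ρx g)
    (hyadd : ∀ f g : Polynomial ℂ, ρy (f + g) = ρy f + ρy g)
    (hhadd : ∀ f g : Polynomial ℂ, ρh (f + g) = ρh f + ρh g)
    (hxsmul : ∀ (z : ℂ) (f : Polynomial ℂ), ρx (z • f) = z • ρx f)
    (hysmul : ∀ (z : ℂ) (f : Polynomial ℂ), ρy (z • f) = z • ρy f)
    (hhsmul : ∀ (z : ℂ) (f : Polynomial ℂ), ρh (z • f) = z • ρh f)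
    (hxy : ∀ f g : Polynomial ℂ, ρx f * ρy g - ρy g * ρx f = ρh (f * g))
    (hhx : ∀ f g : Polynomial ℂ, ρh f * ρx g - ρx g * ρh f = (2 : ℂ) • ρx (f * g))
    (hhy : ∀ f g : Polynomial ℂ, ρh f * ρy g - ρy g * ρh f = -((2 : ℂ) • ρy (f * g)))
    (hxx : ∀ f g : Polynomial ℂ, ρx f * ρx g = ρx g * ρx f)
    (hyy : ∀ f g : Polynomial ℂ, ρy f * ρy g = ρy g * ρy f)
    (hhh : ∀ f g : Polynomial ℂ, ρh f * ρh g = ρh g * ρh f)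
    (v : V) (hv : ∀ r : ℕ, ρx (Polynomial.X ^ r) v = 0)
    (P : ℕ → Module.End ℂ V)
    (hP0 : P 0 = 1)
    (hPrec : ∀ r : ℕ, 1 ≤ r →
      (r : ℂ) • P r = -∑ p ∈ Finset.Icc 1 r, ρh (Polynomial.X ^ p) * P (r - p))
    : ∀ r : ℕ,
      ((ρx 1) ^ r * (ρy Polynomial.X) ^ (r + 1)) v
        = ((-1 : ℂ) ^ r * (r.factorial : ℂ) * ((r + 1).factorial : ℂ)) •
            ∑ s ∈ Finset.range (r + 1), ρy (Polynomial.X ^ (s + 1)) (P (r - s) v) := by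
  intro r
  have H : CurrentRelations (fun i => ρx (Polynomial.X ^ i)) (fun i => ρy (Polynomial.X ^ i))
      (fun i => ρh (Polynomial.X ^ i)) :=
    { xy := fun i j => by rw [hxy, pow_add]
      hx := fun i j => by rw [hhx, pow_add]
      hy := fun i j => by rw [hhy, pow_add]
      xx := fun i j => hxx _ _
      yy := fun i j => hyy _ _
      hh := fun i j => hhh _ _ }
  have hP : ∀ r : ℕ, ((r : ℂ) + 1) • P (r + 1) =
      -∑ p ∈ Finset.range (r + 1), ρh (Polynomial.X ^ (p + 1)) * P (r - p) := by
    intro r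
    have e := hPrec (r + 1) (by omega)
    rw [← Finset.Ico_add_one_right_eq_Icc, Finset.sum_Ico_eq_sum_range] at e
    push_cast at e
    rw [e]
    refine congrArg _ (Finset.sum_congr rfl fun p _ => ?_)
    rw [add_comm 1 p, Nat.add_sub_add_right]
  have hr : (r.factorial : ℂ) ≠ 0 := Nat.cast_ne_zero.2 r.factorial_ne_zero
  have hr' : ((r + 1).factorial : ℂ) ≠ 0 := Nat.cast_ne_zero.2 (r + 1).factorial_ne_zero
  have e := H.garland hP0 hP r hv
  simp only [dividedPow, pow_zero, pow_one, LinearMap.smul_apply, map_smul, smul_smul] at e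
  rw [Module.End.mul_apply, mul_comm ((-1 : ℂ) ^ r), mul_right_comm, mul_smul _ ((-1 : ℂ) ^ r), ← e,
    smul_smul, ← mul_inv_rev,
    mul_inv_cancel₀ (mul_ne_zero hr hr'), one_smul]
end

section
/- The ℂ-algebra B is either one-dimensional or infinite-dimensional over ℂ. Moreover, dim_ℂ B = 1 if and only if both of the following hold: (i) for every i ≠ j with m_i > 0 one has c_i > 0; (ii) N < c_j, and N < c_i for every i ≠ j with m_i > 0. -/
/-- The ideal of `ℂ[x_{i,r} : 1 ≤ i ≤ n, r ≥ 1]` generated by the variables `x_{i,r}` with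
`i ≠ j`, `r > m i`, together with all squarefree monomials
`x_{i₁,r₁} ⋯ x_{i_s,r_s}` (`s ≥ 1`, `i₁ < ⋯ < i_s`, `r_l ≥ 1`) with `Σ_l c_{i_l}·r_l > N`. -/
noncomputable abbrev srIdeal (n : ℕ) (j : Fin n) (N : ℕ) (c m : Fin n → ℕ) :
    Ideal (MvPolynomial (Fin n × ℕ+) ℂ) :=
  Ideal.span
    ({P | ∃ (i : Fin n) (r : ℕ+), i ≠ j ∧ m i < (r : ℕ) ∧ P = MvPolynomial.X (i, r)} ∪
     {P | ∃ (T : Finset (Fin n)) (r : Fin n → ℕ+), T.Nonempty ∧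
        N < ∑ i ∈ T, c i * (r i : ℕ) ∧ P = ∏ i ∈ T, MvPolynomial.X (i, r i)})

/-- The quotient algebra `B` of Statements 16/17. -/
noncomputable abbrev Bquot (n : ℕ) (j : Fin n) (N : ℕ) (c m : Fin n → ℕ) : Type :=
  MvPolynomial (Fin n × ℕ+) ℂ ⧸ srIdeal n j N c m

/-- The ideal `srIdeal` is contained in the kernel of an algebra map which kills every variable
except possibly one variable `x_v` that is not itself a generator. -/
lemma srIdeal_le_ker {A : Type*} [CommRing A] [Algebra ℂ A] {n N : ℕ} {j : Fin n}
    {c m : Fin n → ℕ} (f : Fin n × ℕ+ → A)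
    (hf : ∀ (i : Fin n) (r : ℕ+), (i ≠ j ∧ m i < (r : ℕ)) ∨ N < c i * (r : ℕ) → f (i, r) = 0)
    (v : Fin n × ℕ+) (hv : ∀ w, w ≠ v → f w = 0) :
    srIdeal n j N c m ≤ RingHom.ker (MvPolynomial.aeval (R := ℂ) f) := by
  refine Ideal.span_le.2 ?_
  rintro P (⟨i, r, hij, hr, rfl⟩ | ⟨T, r, hT, hN, rfl⟩)
  · simpa using hf i r (Or.inl ⟨hij, hr⟩)
  · simp only [SetLike.mem_coe, RingHom.mem_ker, map_prod, MvPolynomial.aeval_X]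
    by_cases h : ∀ i ∈ T, (i, r i) = v
    · obtain ⟨k, hk⟩ := hT
      have hTk : T = {k} := Finset.eq_singleton_iff_unique_mem.2
        ⟨hk, fun i hi => congrArg Prod.fst ((h i hi).trans (h k hk).symm)⟩
      subst hTk
      simpa using hf k (r k) (Or.inr (by simpa using hN))
    · push Not at h
      obtain ⟨i, hi, hiv⟩ := h
      exact Finset.prod_eq_zero hi (hv _ hiv)

lemma X_mem_srIdeal {n N : ℕ} {j : Fin n} {c m : Fin n → ℕ} {i : Fin n} {r : ℕ+}
    (h : (i ≠ j ∧ m i < (r : ℕ)) ∨ N < c i * (r : ℕ)) :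
    MvPolynomial.X (i, r) ∈ srIdeal n j N c m := by
  refine Ideal.subset_span ?_
  rcases h with ⟨hij, hr⟩ | hN
  · exact Or.inl ⟨i, r, hij, hr, rfl⟩
  · exact Or.inr ⟨{i}, fun _ => r, Finset.singleton_nonempty i, by simpa using hN, by simp⟩

/-- If every variable lies in the ideal, the quotient is one-dimensional. -/
lemma finrank_Bquot_eq_one {n N : ℕ} {j : Fin n} {c m : Fin n → ℕ}
    (h : ∀ i (r : ℕ+), (i ≠ j ∧ m i < (r : ℕ)) ∨ N < c i * (r : ℕ)) :
    Module.finrank ℂ (Bquot n j N c m) = 1 := by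
  have hne : (1 : Bquot n j N c m) ≠ 0 := by
    intro h1
    have hmem : (1 : MvPolynomial (Fin n × ℕ+) ℂ) ∈ srIdeal n j N c m :=
      Ideal.Quotient.eq_zero_iff_mem.1 h1
    have hker := srIdeal_le_ker (A := ℂ) (fun _ => 0) (fun _ _ _ => rfl) (j, 1)
      (fun _ _ => rfl) hmem
    simp at hker
  refine (finrank_eq_one_iff_of_nonzero' _ hne).2 fun w => ?_
  obtain ⟨p, rfl⟩ := Ideal.Quotient.mk_surjective w
  induction p using MvPolynomial.induction_on with
  | C a => exact ⟨a, (Algebra.algebraMap_eq_smul_one a).symm⟩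
  | add p q hp hq =>
    obtain ⟨a, ha⟩ := hp
    obtain ⟨b, hb⟩ := hq
    exact ⟨a + b, by rw [add_smul, ha, hb, map_add]⟩
  | mul_X p v _ =>
    refine ⟨0, ?_⟩
    rw [zero_smul, eq_comm, Ideal.Quotient.eq_zero_iff_mem]
    exact Ideal.mul_mem_left _ _ (X_mem_srIdeal (h v.1 v.2))

/-- If some variable is not a generator of the ideal, the quotient surjects onto `ℂ[t]`. -/
lemma not_finite_Bquot {n N : ℕ} {j : Fin n} {c m : Fin n → ℕ} {i : Fin n} {r : ℕ+}
    (h : ¬ ((i ≠ j ∧ m i < (r : ℕ)) ∨ N < c i * (r : ℕ))) :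
    ¬ Module.Finite ℂ (Bquot n j N c m) := by
  classical
  intro hfin
  let f : Fin n × ℕ+ → Polynomial ℂ := fun w => if w = (i, r) then Polynomial.X else 0
  have hker : srIdeal n j N c m ≤ RingHom.ker (MvPolynomial.aeval (R := ℂ) f) := by
    refine srIdeal_le_ker f (fun k s hks => if_neg ?_) (i, r) fun w hw => if_neg hw
    rintro ⟨⟩
    exact h hks
  let φ : Bquot n j N c m →ₐ[ℂ] Polynomial ℂ :=
    Ideal.Quotient.liftₐ _ (MvPolynomial.aeval f) fun _ ha => hker ha
  have hφ : Function.Surjective φ := by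
    intro p
    refine ⟨Ideal.Quotient.mk _ (Polynomial.aeval (MvPolynomial.X (i, r)) p), ?_⟩
    change MvPolynomial.aeval f (Polynomial.aeval (MvPolynomial.X (i, r)) p) = p
    rw [← Polynomial.aeval_algHom_apply]
    simp [f]
  exact Polynomial.not_finite (R := ℂ) (Module.Finite.of_surjective φ.toLinearMap hφ)

lemma forall_variable_killed_iff {n N : ℕ} {j : Fin n} {c m : Fin n → ℕ} :
    (∀ i (r : ℕ+), (i ≠ j ∧ m i < (r : ℕ)) ∨ N < c i * (r : ℕ)) ↔
      ((∀ i : Fin n, i ≠ j → 0 < m i → 0 < c i) ∧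
       (N < c j ∧ ∀ i : Fin n, i ≠ j → 0 < m i → N < c i)) := by
  constructor
  · intro h
    have hi : ∀ i : Fin n, i ≠ j → 0 < m i → N < c i := fun i _ hm => by
      rcases h i 1 with ⟨-, h1⟩ | h1
      · exact absurd h1 (by simpa using hm.ne')
      · simpa using h1
    refine ⟨fun i hij hm => (Nat.zero_le N).trans_lt (hi i hij hm), ?_, hi⟩
    simpa using h j 1
  · rintro ⟨-, hj, hi⟩ i r
    have hle : c i ≤ c i * (r : ℕ) := Nat.le_mul_of_pos_right _ r.pos
    rcases eq_or_ne i j with rfl | hij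
    · exact Or.inr (hj.trans_le hle)
    · rcases Nat.eq_zero_or_pos (m i) with hm | hm
      · exact Or.inl ⟨hij, hm ▸ r.pos⟩
      · exact Or.inr ((hi i hij hm).trans_le hle)

/-- The algebra B is either one-dimensional or infinite-dimensional over ℂ,
and dim B = 1 iff (i) c_i > 0 for every i ≠ j with m_i > 0, and (ii) N < c_j and N < c_i for
every i ≠ j with m_i > 0. -/
theorem statement16 (n N : ℕ) (j : Fin n) (c m : Fin n → ℕ) (hcj : 1 ≤ c j) :
    (Module.finrank ℂ (Bquot n j N c m) = 1 ∨ ¬ Module.Finite ℂ (Bquot n j N c m)) ∧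
    (Module.finrank ℂ (Bquot n j N c m) = 1 ↔
      ((∀ i : Fin n, i ≠ j → 0 < m i → 0 < c i) ∧
       (N < c j ∧ ∀ i : Fin n, i ≠ j → 0 < m i → N < c i))) := by
  rw [← forall_variable_killed_iff]
  by_cases h : ∀ i (r : ℕ+), (i ≠ j ∧ m i < (r : ℕ)) ∨ N < c i * (r : ℕ)
  · exact ⟨Or.inl (finrank_Bquot_eq_one h), fun _ => h, finrank_Bquot_eq_one⟩
  · have hinf : ¬ Module.Finite ℂ (Bquot n j N c m) := by
      push Not at h
      obtain ⟨i, r, hir⟩ := h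
      exact not_finite_Bquot (i := i) (r := r) (by grind)
    refine ⟨Or.inr hinf, fun h1 => ?_, finrank_Bquot_eq_one⟩
    exact absurd (Module.finite_of_finrank_pos (h1 ▸ Nat.one_pos)) hinf
end

section
/- Assume in addition that c_i ∈ {0, 1} for every i (so c_j = 1). Then the Krull dimension of B equals N + Σ_{i : c_i = 0} m_i. -/
open MvPolynomial in
/-- If a polynomial algebra over a field surjects onto `A` and every variable outside the range of
an injection `f : ι → σ` maps to zero, then `dim A ≤ #ι`. -/
theorem ringKrullDim_le_natCard_of_vanishing {k σ ι A : Type*} [Field k] [CommRing A] [Algebra k A]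
    [Finite ι] {f : ι → σ} (hf : Function.Injective f) (φ : MvPolynomial σ k →ₐ[k] A)
    (hφ : Function.Surjective φ) (h : ∀ v ∉ Set.range f, φ (X v) = 0) :
    ringKrullDim A ≤ Nat.card ι := by
  have key : (φ.comp (rename f)).comp (killCompl hf) = φ := by
    ext v
    by_cases hv : v ∈ Set.range f
    · obtain ⟨w, rfl⟩ := hv
      rw [AlgHom.comp_apply, ← rename_X f w, killCompl_rename_app, AlgHom.comp_apply]
    · simp [killCompl, hv, h v hv]
  have hs : Function.Surjective (φ.comp (rename f) : MvPolynomial ι k →ₐ[k] A) := fun a ↦ by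
    obtain ⟨p, rfl⟩ := hφ a
    exact ⟨killCompl hf p, DFunLike.congr_fun key p⟩
  refine (ringKrullDim_le_of_surjective
    (φ.comp (rename f) : MvPolynomial ι k →ₐ[k] A).toRingHom hs).trans ?_
  rw [ringKrullDim_of_isNoetherianRing, ringKrullDim_eq_zero_of_field, zero_add]

open MvPolynomial in
/-- If an ideal `I` vanishes on the coordinate subspace spanned by the coordinates `f : ι → σ`,
then `#ι ≤ dim k[σ]/I`. -/
theorem natCard_le_ringKrullDim_quotient {k σ ι : Type*} [Field k] [Finite ι] {f : ι → σ}
    (hf : Function.Injective f) (I : Ideal (MvPolynomial σ k))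
    (h : I ≤ RingHom.ker (killCompl hf : MvPolynomial σ k →ₐ[k] MvPolynomial ι k)) :
    (Nat.card ι : WithBot ℕ∞) ≤ ringKrullDim (MvPolynomial σ k ⧸ I) := by
  have hs : Function.Surjective (killCompl hf : MvPolynomial σ k →ₐ[k] MvPolynomial ι k) :=
    fun p ↦ ⟨rename f p, killCompl_rename_app hf p⟩
  have := ringKrullDim_le_of_surjective
    (Ideal.Quotient.lift I (killCompl hf : MvPolynomial σ k →ₐ[k] MvPolynomial ι k).toRingHom
      fun a ha ↦ h ha)
    (Ideal.Quotient.lift_surjective_of_surjective _ _ hs)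
  rwa [ringKrullDim_of_isNoetherianRing, ringKrullDim_eq_zero_of_field, zero_add] at this

theorem ringKrullDim_le_of_forall_quotient_prime {R : Type*} [CommRing R] {d : WithBot ℕ∞}
    (h : ∀ p : Ideal R, p.IsPrime → ringKrullDim (R ⧸ p) ≤ d) : ringKrullDim R ≤ d := by
  refine iSup_le fun l ↦ ?_
  refine le_trans ?_ (h l.head.asIdeal l.head.isPrime)
  rw [ringKrullDim_quotient]
  let l' : LTSeries (PrimeSpectrum.zeroLocus (R := R) l.head.asIdeal) :=
    { length := l.length
      toFun := fun i ↦ ⟨l i, l.head_le i⟩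
      step := fun i ↦ l.step i }
  exact le_iSup (fun l : LTSeries _ ↦ (l.length : WithBot ℕ∞)) l'

/-- The elements of the disjoint union of the intervals `[1, M i]`, seen as pairs `(i, r)`. -/
def intervalPair {α : Type*} (M : α → ℕ) (p : Σ i, Fin (M i)) : α × ℕ+ :=
  (p.1, (p.2 : ℕ).succPNat)

theorem intervalPair_injective {α : Type*} (M : α → ℕ) :
    Function.Injective (intervalPair M) := by
  rintro ⟨i, a⟩ ⟨i', b⟩ h
  obtain ⟨rfl, h⟩ := Prod.mk.inj h
  exact congrArg (Sigma.mk i) (Fin.ext (Nat.succPNat_injective h))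

theorem mem_range_intervalPair {α : Type*} {M : α → ℕ} {v : α × ℕ+} :
    v ∈ Set.range (intervalPair M) ↔ (v.2 : ℕ) ≤ M v.1 := by
  obtain ⟨i, r⟩ := v
  constructor
  · rintro ⟨⟨i', a⟩, h⟩
    obtain ⟨rfl, rfl⟩ := Prod.mk.inj h
    exact a.2
  · intro h
    refine ⟨⟨i, ⟨r.natPred, ?_⟩⟩, ?_⟩
    · have := r.natPred_add_one
      simp only at h
      omega
    · simp [intervalPair]

theorem natCard_sigma_fin {α : Type*} [Fintype α] (M : α → ℕ) :
    Nat.card (Σ i, Fin (M i)) = ∑ i, M i := by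
  simp

theorem exists_max_or_zero {S : Set ℕ+} {b : ℕ} (hb : ∀ r ∈ S, (r : ℕ) ≤ b) :
    ∃ M ≤ b, (∀ r ∈ S, (r : ℕ) ≤ M) ∧ (M ≠ 0 → ∃ r ∈ S, (r : ℕ) = M) := by
  rcases S.eq_empty_or_nonempty with rfl | hS
  · exact ⟨0, by simp⟩
  · have hbdd : BddAbove ((fun r : ℕ+ ↦ (r : ℕ)) '' S) := ⟨b, by
      rintro _ ⟨r, hr, rfl⟩; exact hb r hr⟩
    obtain ⟨r, hr, h⟩ := Nat.sSup_mem (hS.image _) hbdd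
    refine ⟨r, hb r hr, fun s hs ↦ ?_, fun _ ↦ ⟨r, hr, rfl⟩⟩
    have := le_csSup hbdd (Set.mem_image_of_mem _ hs)
    exact this.trans h.ge

/-- A set of variables containing the support of no generator of `srIdeal` lies in a union of
intervals of total length at most `N + Σ_{c i = 0} m i`. -/
theorem exists_interval_bound {n N : ℕ} {j : Fin n} {c m : Fin n → ℕ} (hcj : 1 ≤ c j)
    (F : Set (Fin n × ℕ+)) (h₁ : ∀ i r, i ≠ j → (i, r) ∈ F → (r : ℕ) ≤ m i)
    (h₂ : ∀ (T : Finset (Fin n)) (r : Fin n → ℕ+), T.Nonempty → (∀ i ∈ T, (i, r i) ∈ F) →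
      ∑ i ∈ T, c i * (r i : ℕ) ≤ N) :
    ∃ M : Fin n → ℕ, (∀ v ∈ F, (v.2 : ℕ) ≤ M v.1) ∧
      ∑ i, M i ≤ N + ∑ i ∈ Finset.univ.filter (fun i ↦ c i = 0), m i := by
  have hb : ∀ i, ∃ M ≤ (if c i = 0 then m i else N), (∀ r ∈ {r | (i, r) ∈ F}, (r : ℕ) ≤ M) ∧
      (M ≠ 0 → ∃ r ∈ {r | (i, r) ∈ F}, (r : ℕ) = M) := fun i ↦ by
    refine exists_max_or_zero fun r hr ↦ ?_
    split_ifs with hc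
    · exact h₁ i r (by rintro rfl; omega) hr
    · have := h₂ {i} (fun _ ↦ r) (by simp) (by simpa using hr)
      rw [Finset.sum_singleton] at this
      exact (Nat.le_mul_of_pos_left _ (Nat.pos_of_ne_zero hc)).trans this
  choose M hM hle hmem using hb
  refine ⟨M, fun v hv ↦ hle v.1 v.2 hv, ?_⟩
  have hr : ∀ i, ∃ r : ℕ+, M i ≠ 0 → (i, r) ∈ F ∧ (r : ℕ) = M i := fun i ↦ by
    by_cases hi : M i = 0
    · exact ⟨1, fun h ↦ (h hi).elim⟩
    · obtain ⟨r, hr⟩ := hmem i hi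
      exact ⟨r, fun _ ↦ hr⟩
  choose r hr using hr
  rw [← Finset.sum_filter_add_sum_filter_not Finset.univ (fun i ↦ c i = 0), add_comm]
  refine add_le_add ?_ (Finset.sum_le_sum fun i hi ↦ ?_)
  · rw [← Finset.sum_filter_ne_zero]
    set T := (Finset.univ.filter fun i ↦ ¬ c i = 0).filter fun i ↦ M i ≠ 0 with hT
    have hmT : ∀ i ∈ T, c i ≠ 0 ∧ M i ≠ 0 := fun i hi ↦ by simpa [hT] using hi
    rcases T.eq_empty_or_nonempty with h0 | hne
    · simp [h0]
    · refine le_trans (Finset.sum_le_sum fun i hi ↦ ?_)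
        (h₂ T r hne fun i hi ↦ (hr i (hmT i hi).2).1)
      rw [(hr i (hmT i hi).2).2]
      exact Nat.le_mul_of_pos_left _ (Nat.pos_of_ne_zero (hmT i hi).1)
  · have := hM i
    rwa [if_pos (Finset.mem_filter.mp hi).2] at this

theorem ringKrullDim_Bquot_le (n N : ℕ) (j : Fin n) (c m : Fin n → ℕ) (hcj : 1 ≤ c j) :
    ringKrullDim (Bquot n j N c m)
      ≤ ((N + ∑ i ∈ Finset.univ.filter (fun i => c i = 0), m i : ℕ) : WithBot ℕ∞) := by
  refine ringKrullDim_le_of_forall_quotient_prime fun p hp ↦ ?_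
  let φ : MvPolynomial (Fin n × ℕ+) ℂ →ₐ[ℂ] Bquot n j N c m ⧸ p :=
    (Ideal.Quotient.mkₐ ℂ p).comp (Ideal.Quotient.mkₐ ℂ (srIdeal n j N c m))
  have hφ : Function.Surjective φ :=
    (Ideal.Quotient.mkₐ_surjective ℂ p).comp (Ideal.Quotient.mkₐ_surjective ℂ _)
  have hI : ∀ P ∈ srIdeal n j N c m, φ P = 0 := fun P hP ↦ by
    simp [φ, Ideal.Quotient.eq_zero_iff_mem.mpr hP]
  obtain ⟨M, hM, hsum⟩ := exists_interval_bound (N := N) (m := m) hcj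
    {v | φ (MvPolynomial.X v) ≠ 0}
    (fun i r hij hv ↦ by
      by_contra! hlt
      exact hv (hI _ (Ideal.subset_span (Or.inl ⟨i, r, hij, hlt, rfl⟩))))
    (fun T r hT hv ↦ by
      by_contra! hlt
      have := hI _ (Ideal.subset_span (Or.inr ⟨T, r, hT, hlt, rfl⟩))
      rw [map_prod, Finset.prod_eq_zero_iff] at this
      obtain ⟨i, hi, h0⟩ := this
      exact hv i hi h0)
  refine (ringKrullDim_le_natCard_of_vanishing (intervalPair_injective M) φ hφ
    fun v hv ↦ ?_).trans ?_
  · by_contra h0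
    exact hv (mem_range_intervalPair.mpr (hM v h0))
  · rw [natCard_sigma_fin]
    exact_mod_cast hsum

theorem le_ringKrullDim_Bquot (n N : ℕ) (j : Fin n) (c m : Fin n → ℕ) (hcj : c j = 1) :
    ((N + ∑ i ∈ Finset.univ.filter (fun i => c i = 0), m i : ℕ) : WithBot ℕ∞)
      ≤ ringKrullDim (Bquot n j N c m) := by
  let M : Fin n → ℕ := fun i ↦ (if i = j then N else 0) + if c i = 0 then m i else 0
  have hsum : ∑ i, M i = N + ∑ i ∈ Finset.univ.filter (fun i => c i = 0), m i := by
    simp [M, Finset.sum_add_distrib, Finset.sum_filter]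
  have hX : ∀ v : Fin n × ℕ+, M v.1 < v.2 →
      MvPolynomial.killCompl (R := ℂ) (intervalPair_injective M) (MvPolynomial.X v) = 0 :=
    fun v hv ↦ by
      have : v ∉ Set.range (intervalPair M) := by rwa [mem_range_intervalPair, not_le]
      rw [MvPolynomial.killCompl, MvPolynomial.aeval_X, dif_neg this]
  rw [← hsum, ← natCard_sigma_fin]
  refine natCard_le_ringKrullDim_quotient (intervalPair_injective M) _ (Ideal.span_le.mpr ?_)
  rintro P (⟨i, r, hij, hr, rfl⟩ | ⟨T, r, hT, hr, rfl⟩)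
  · refine hX _ (lt_of_le_of_lt ?_ hr)
    simp only [M, if_neg hij]
    split_ifs <;> simp
  · obtain ⟨i, hi, hlt⟩ : ∃ i ∈ T, M i < r i := by
      by_contra! hle
      refine hr.not_ge ?_
      calc ∑ i ∈ T, c i * (r i : ℕ) ≤ ∑ i ∈ T, c i * M i :=
            Finset.sum_le_sum fun i hi ↦ Nat.mul_le_mul_left _ (hle i hi)
        _ ≤ ∑ i, c i * M i := Finset.sum_le_sum_of_subset (Finset.subset_univ T)
        _ = ∑ i, if i = j then N else 0 := Finset.sum_congr rfl fun i _ ↦ by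
            simp only [M]
            by_cases hij : i = j
            · simp [hij, hcj]
            · by_cases hc : c i = 0 <;> simp [hij, hc]
        _ = N := by simp
    change MvPolynomial.killCompl (intervalPair_injective M) _ = 0
    rw [map_prod]
    exact Finset.prod_eq_zero hi (hX _ hlt)

/-- If every c_i ∈ {0,1} (so c_j = 1), the Krull dimension of B equals
N + Σ_{i : c_i = 0} m_i. -/
theorem statement17 (n N : ℕ) (j : Fin n) (c m : Fin n → ℕ) (hcj : 1 ≤ c j)
    (hc01 : ∀ i, c i ≤ 1) :
    ringKrullDim (Bquot n j N c m)
      = ((N + ∑ i ∈ Finset.univ.filter (fun i => c i = 0), m i : ℕ) : WithBot ℕ∞) := by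
  exact le_antisymm (ringKrullDim_Bquot_le n N j c m hcj)
    (le_ringKrullDim_Bquot n N j c m (le_antisymm (hc01 j) hcj))
end

section
/- The maximal admissible subsets (with respect to inclusion) are exactly the sets F_a = {y_1, …, y_a} ∪ {z_1, …, z_{N−a}} ∪ X for 0 ≤ a ≤ p; in particular, every maximal admissible subset has cardinality N + |X| (the collection of admissible sets is a pure simplicial complex). -/
/-- On the set of symbols {y_1,…,y_p} ∪ {z_1,…,z_N} ∪ X (0 ≤ p ≤ N), call a
subset F admissible if there is no pair (r,s) with y_r ∈ F, z_s ∈ F and r + s > N.  The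
maximal admissible subsets are exactly F_a = {y_1,…,y_a} ∪ {z_1,…,z_{N−a}} ∪ X for 0 ≤ a ≤ p;
in particular every maximal admissible subset has cardinality N + |X|. -/
theorem statement18 (N p : ℕ) (hp : p ≤ N) (X : Type*) [Fintype X] [DecidableEq X]
    (Adm : Finset ((Fin p ⊕ Fin N) ⊕ X) → Prop)
    (hAdm : ∀ F, Adm F ↔ ¬∃ (r : Fin p) (s : Fin N),
      Sum.inl (Sum.inl r) ∈ F ∧ Sum.inl (Sum.inr s) ∈ F ∧
      N < ((r : ℕ) + 1) + ((s : ℕ) + 1))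
    (Fa : ℕ → Finset ((Fin p ⊕ Fin N) ⊕ X))
    (hFa : ∀ a, Fa a =
      ((Finset.univ.filter (fun r : Fin p => (r : ℕ) < a)).image
          (fun r => Sum.inl (Sum.inl r))) ∪
      ((Finset.univ.filter (fun s : Fin N => (s : ℕ) < N - a)).image
          (fun s => Sum.inl (Sum.inr s))) ∪
      (Finset.univ.image Sum.inr)) :
    (∀ F, (Adm F ∧ ∀ G, Adm G → F ⊆ G → G = F) ↔ ∃ a ≤ p, F = Fa a) ∧
    (∀ F, Adm F → (∀ G, Adm G → F ⊆ G → G = F) →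
      F.card = N + Fintype.card X) := by
  have mem_y : ∀ a (r : Fin p), Sum.inl (Sum.inl r) ∈ Fa a ↔ (r : ℕ) < a := by
    intro a r
    simp [hFa]
  have mem_z : ∀ a (s : Fin N), Sum.inl (Sum.inr s) ∈ Fa a ↔ (s : ℕ) < N - a := by
    intro a s
    simp [hFa]
  have mem_x : ∀ a (x : X), Sum.inr x ∈ Fa a := by
    intro a x
    simp [hFa]
  have adm_Fa : ∀ a, Adm (Fa a) := by
    intro a
    rw [hAdm]
    rintro ⟨r, s, hr, hs, h⟩
    rw [mem_y] at hr
    rw [mem_z] at hs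
    omega
  have exists_subset_Fa : ∀ F, Adm F → ∃ a ≤ p, F ⊆ Fa a := by
    intro F hF
    rw [hAdm] at hF
    push Not at hF
    classical
    have hex : ∃ a, ∀ r : Fin p, Sum.inl (Sum.inl r) ∈ F → (r : ℕ) < a :=
      ⟨p, fun r _ => r.2⟩
    refine ⟨Nat.find hex, Nat.find_min' hex fun r _ => r.2, ?_⟩
    rintro ((r | s) | x) hv
    · exact (mem_y _ r).2 (Nat.find_spec hex r hv)
    · rw [mem_z]
      rcases Nat.eq_zero_or_pos (Nat.find hex) with h0 | hpos
      · rw [h0]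
        exact s.2
      · have hmin := Nat.find_min hex (Nat.sub_lt hpos one_pos)
        push Not at hmin
        obtain ⟨r, hr, hle⟩ := hmin
        have := hF r s hr hv
        omega
    · exact mem_x _ x
  have maximal_Fa : ∀ a ≤ p, ∀ G, Adm G → Fa a ⊆ G → G = Fa a := by
    intro a ha G hG hsub
    rw [hAdm] at hG
    push Not at hG
    refine Finset.Subset.antisymm ?_ hsub
    rintro ((r | s) | x) hv
    · rw [mem_y]
      by_contra! hlt
      have hr := r.2
      have := hG r ⟨N - a - 1, by omega⟩ hv (hsub ((mem_z _ _).2 (by simp only; omega)))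
      simp only at this
      omega
    · rw [mem_z]
      by_contra! hlt
      have hs := s.2
      have := hG ⟨a - 1, by omega⟩ s (hsub ((mem_y _ _).2 (by simp only; omega))) hv
      simp only at this
      omega
    · exact mem_x _ x
  have card_Fa : ∀ a ≤ p, (Fa a).card = N + Fintype.card X := by
    intro a ha
    rw [hFa, Finset.card_union_of_disjoint, Finset.card_union_of_disjoint,
      Finset.card_image_of_injective _ (fun _ _ h => Sum.inl_injective (Sum.inl_injective h)),
      Finset.card_image_of_injective _ (fun _ _ h => Sum.inr_injective (Sum.inl_injective h)),
      Finset.card_image_of_injective _ Sum.inr_injective,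
      Fin.card_filter_val_lt, Fin.card_filter_val_lt, Finset.card_univ]
    · omega
    · simp [Finset.disjoint_left]
    · rw [Finset.disjoint_left]
      rintro ((r | s) | x) <;> simp
  have maximal_iff : ∀ F, (Adm F ∧ ∀ G, Adm G → F ⊆ G → G = F) ↔ ∃ a ≤ p, F = Fa a := by
    intro F
    constructor
    · rintro ⟨hF, hmax⟩
      obtain ⟨a, ha, hsub⟩ := exists_subset_Fa F hF
      exact ⟨a, ha, (hmax _ (adm_Fa a) hsub).symm⟩
    · rintro ⟨a, ha, rfl⟩
      exact ⟨adm_Fa a, maximal_Fa a ha⟩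
  refine ⟨maximal_iff, fun F hF hmax => ?_⟩
  obtain ⟨a, ha, rfl⟩ := (maximal_iff F).1 ⟨hF, hmax⟩
  exact card_Fa a ha
end
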